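/- arXiv:1110.2559 — 4 statements merged into one kernel-verified Lean document; each statement's English description precedes it below -/
import Mathlib

section
/- None of the seven binary sextics (i) z1^4 z2^2, (ii) z1^4(z1^2+z2^2), (iii) z1^3 z2^3, (iv) z1^5 z2, (v) z1(z1^5+z2^5), (vi) 2z1^6+18z1^5z2+10z1^3z2^3−z2^6, (vii) 184z1^6−192z1^5z2−300z1^4z2^2−320z1^3z2^3−150z1^2z2^4−48z1z2^5+23z2^6 is linearly equivalent to a sextic in Sylvester Canonical Form. -/
open MvPolynomial

/-- The polynomial obtained from `Q(z)` by the linear change of variables `z ↦ C z`;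
its value at `w` is `Q (C w)`. -/
noncomputable def substMat (M : Matrix (Fin 2) (Fin 2) ℂ) (Q : MvPolynomial (Fin 2) ℂ) :
    MvPolynomial (Fin 2) ℂ :=
  aeval (fun i => MvPolynomial.C (M i 0) * X 0 + MvPolynomial.C (M i 1) * X 1) Q

/-- Two binary forms are linearly equivalent if one is obtained from the other by an
invertible linear change of the variables. -/
def LinEquiv (Q R : MvPolynomial (Fin 2) ℂ) : Prop :=
  ∃ M : Matrix (Fin 2) (Fin 2) ℂ, IsUnit M.det ∧ substMat M Q = R

/-- A binary sextic is in Sylvester Canonical Form if it equals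
`a u^6 + b v^6 + c w^6 + d uvw (u−v)(v−w)(w−u)` for linear forms `u, v, w` with
`u + v + w = 0`, any two of which are linearly independent. -/
def IsSylvester (S : MvPolynomial (Fin 2) ℂ) : Prop :=
  ∃ (a b c d : ℂ) (u v w : MvPolynomial (Fin 2) ℂ),
    u.IsHomogeneous 1 ∧ v.IsHomogeneous 1 ∧ w.IsHomogeneous 1 ∧
    u + v + w = 0 ∧
    LinearIndependent ℂ ![u, v] ∧ LinearIndependent ℂ ![v, w] ∧
    LinearIndependent ℂ ![u, w] ∧
    S = MvPolynomial.C a * u ^ 6 + MvPolynomial.C b * v ^ 6 + MvPolynomial.C c * w ^ 6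
        + MvPolynomial.C d * (u * v * w * (u - v) * (v - w) * (w - u))

/-- The seven exceptional binary sextics of Theorem 5.2. -/
noncomputable def exceptionalSextic : Fin 7 → MvPolynomial (Fin 2) ℂ :=
  ![X 0 ^ 4 * X 1 ^ 2,
    X 0 ^ 4 * (X 0 ^ 2 + X 1 ^ 2),
    X 0 ^ 3 * X 1 ^ 3,
    X 0 ^ 5 * X 1,
    X 0 * (X 0 ^ 5 + X 1 ^ 5),
    2 * X 0 ^ 6 + 18 * X 0 ^ 5 * X 1 + 10 * X 0 ^ 3 * X 1 ^ 3 - X 1 ^ 6,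
    184 * X 0 ^ 6 - 192 * X 0 ^ 5 * X 1 - 300 * X 0 ^ 4 * X 1 ^ 2 - 320 * X 0 ^ 3 * X 1 ^ 3
      - 150 * X 0 ^ 2 * X 1 ^ 4 - 48 * X 0 * X 1 ^ 5 + 23 * X 1 ^ 6]

namespace SylvesterAux

/-- A degree one form is a linear form. -/
lemma linear_of_homog {u : MvPolynomial (Fin 2) ℂ} (h : u.IsHomogeneous 1) :
    ∃ p q : ℂ, u = MvPolynomial.C p * X 0 + MvPolynomial.C q * X 1 := by
  have hu : u ∈ homogeneousSubmodule (Fin 2) ℂ 1 := h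
  rw [homogeneousSubmodule_one_eq_span_X, Submodule.mem_span_range_iff_exists_fun] at hu
  obtain ⟨c, hc⟩ := hu
  refine ⟨c 0, c 1, ?_⟩
  rw [← hc, Fin.sum_univ_two, MvPolynomial.smul_eq_C_mul, MvPolynomial.smul_eq_C_mul]

/-- Independent linear forms have nonzero determinant. -/
lemma det_ne {p q r s : ℂ}
    (h : LinearIndependent ℂ ![(MvPolynomial.C p * X 0 + MvPolynomial.C q * X 1 :
      MvPolynomial (Fin 2) ℂ), MvPolynomial.C r * X 0 + MvPolynomial.C s * X 1]) :
    p * s - q * r ≠ 0 := by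
  intro h0
  have h1 := LinearIndependent.pair_iff.mp h
  have e : (MvPolynomial.C (p * s - q * r) : MvPolynomial (Fin 2) ℂ) = 0 := by rw [h0, map_zero]
  simp only [map_sub, map_mul] at e
  have hs := h1 s (-q) (by
    simp only [MvPolynomial.smul_eq_C_mul, map_neg]
    linear_combination (X 0) * e)
  have hr := h1 r (-p) (by
    simp only [MvPolynomial.smul_eq_C_mul, map_neg]
    linear_combination -(X 1) * e)
  have hq : q = 0 := by simpa using hs.2
  have hp : p = 0 := by simpa using hr.2
  have := h1 1 0 (by simp [hp, hq])
  simp at this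

/-- A binary sextic vanishing everywhere has zero coefficients. -/
lemma coeffs_zero {c0 c1 c2 c3 c4 c5 c6 : ℂ}
    (h : ∀ s t : ℂ, c0 * s ^ 6 + c1 * s ^ 5 * t + c2 * s ^ 4 * t ^ 2 + c3 * s ^ 3 * t ^ 3
      + c4 * s ^ 2 * t ^ 4 + c5 * s * t ^ 5 + c6 * t ^ 6 = 0) :
    c1 = 0 ∧ c2 = 0 ∧ c3 = 0 ∧ c4 = 0 ∧ c5 = 0 := by
  have e0 := h 1 0
  have e1 := h 1 1
  have e2 := h 1 (-1)
  have e3 := h 1 2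
  have e4 := h 1 (-2)
  have e5 := h 1 3
  have e6 := h 0 1
  norm_num at e0 e1 e2 e3 e4 e5 e6
  refine ⟨?_, ?_, ?_, ?_, ?_⟩ <;> grind

set_option maxHeartbeats 4000000 in
/-- The eigenvector reformulation: a Sylvester representation gives an eigenvector of the
catalecticant which is a cubic with nonzero discriminant. -/
lemma core {f0 f1 f2 f3 f4 f5 f6 a b c d p1 p2 q1 q2 : ℂ} (hD : p1 * q2 - p2 * q1 ≠ 0)
    (h : ∀ s t : ℂ,
      f0 * (s * p1 + t * q1) ^ 6 + 6 * f1 * (s * p1 + t * q1) ^ 5 * (s * p2 + t * q2)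
      + 15 * f2 * (s * p1 + t * q1) ^ 4 * (s * p2 + t * q2) ^ 2
      + 20 * f3 * (s * p1 + t * q1) ^ 3 * (s * p2 + t * q2) ^ 3
      + 15 * f4 * (s * p1 + t * q1) ^ 2 * (s * p2 + t * q2) ^ 4
      + 6 * f5 * (s * p1 + t * q1) * (s * p2 + t * q2) ^ 5
      + f6 * (s * p2 + t * q2) ^ 6
      = a * s ^ 6 + b * t ^ 6 + c * (s + t) ^ 6
        + d * (2 * s ^ 5 * t + 5 * s ^ 4 * t ^ 2 - 5 * s ^ 2 * t ^ 4 - 2 * s * t ^ 5)) :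
    ∃ l t0 t1 t2 t3 : ℂ,
      f0 * t0 + f1 * t1 + f2 * t2 + f3 * t3 = l * t3 ∧
      3 * (f1 * t0 + f2 * t1 + f3 * t2 + f4 * t3) = -l * t2 ∧
      3 * (f2 * t0 + f3 * t1 + f4 * t2 + f5 * t3) = l * t1 ∧
      f3 * t0 + f4 * t1 + f5 * t2 + f6 * t3 = -l * t0 ∧
      t1 ^ 2 * t2 ^ 2 - 4 * t0 * t2 ^ 3 - 4 * t1 ^ 3 * t3 + 18 * t0 * t1 * t2 * t3
        - 27 * t0 ^ 2 * t3 ^ 2 ≠ 0 := by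
  obtain ⟨c0, hc0⟩ : ∃ z : ℂ, z = 1 * f0 * p1 ^ 6
      + 6 * f1 * p1 ^ 5 * p2
      + 15 * f2 * p1 ^ 4 * p2 ^ 2
      + 20 * f3 * p1 ^ 3 * p2 ^ 3
      + 15 * f4 * p1 ^ 2 * p2 ^ 4
      + 6 * f5 * p1 * p2 ^ 5
      + 1 * f6 * p2 ^ 6
      - (a + c) := ⟨_, rfl⟩
  obtain ⟨c1, hc1⟩ : ∃ z : ℂ, z = 6 * f0 * p1 ^ 5 * q1
      + 6 * f1 * p1 ^ 5 * q2
      + 30 * f1 * p1 ^ 4 * q1 * p2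
      + 30 * f2 * p1 ^ 4 * p2 * q2
      + 60 * f2 * p1 ^ 3 * q1 * p2 ^ 2
      + 60 * f3 * p1 ^ 3 * p2 ^ 2 * q2
      + 60 * f3 * p1 ^ 2 * q1 * p2 ^ 3
      + 60 * f4 * p1 ^ 2 * p2 ^ 3 * q2
      + 30 * f4 * p1 * q1 * p2 ^ 4
      + 30 * f5 * p1 * p2 ^ 4 * q2
      + 6 * f5 * q1 * p2 ^ 5
      + 6 * f6 * p2 ^ 5 * q2
      - (6 * c + 2 * d) := ⟨_, rfl⟩
  obtain ⟨c2, hc2⟩ : ∃ z : ℂ, z = 15 * f0 * p1 ^ 4 * q1 ^ 2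
      + 30 * f1 * p1 ^ 4 * q1 * q2
      + 60 * f1 * p1 ^ 3 * q1 ^ 2 * p2
      + 15 * f2 * p1 ^ 4 * q2 ^ 2
      + 120 * f2 * p1 ^ 3 * q1 * p2 * q2
      + 90 * f2 * p1 ^ 2 * q1 ^ 2 * p2 ^ 2
      + 60 * f3 * p1 ^ 3 * p2 * q2 ^ 2
      + 180 * f3 * p1 ^ 2 * q1 * p2 ^ 2 * q2
      + 60 * f3 * p1 * q1 ^ 2 * p2 ^ 3
      + 90 * f4 * p1 ^ 2 * p2 ^ 2 * q2 ^ 2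
      + 120 * f4 * p1 * q1 * p2 ^ 3 * q2
      + 15 * f4 * q1 ^ 2 * p2 ^ 4
      + 60 * f5 * p1 * p2 ^ 3 * q2 ^ 2
      + 30 * f5 * q1 * p2 ^ 4 * q2
      + 15 * f6 * p2 ^ 4 * q2 ^ 2
      - (15 * c + 5 * d) := ⟨_, rfl⟩
  obtain ⟨c3, hc3⟩ : ∃ z : ℂ, z = 20 * f0 * p1 ^ 3 * q1 ^ 3
      + 60 * f1 * p1 ^ 3 * q1 ^ 2 * q2
      + 60 * f1 * p1 ^ 2 * q1 ^ 3 * p2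
      + 60 * f2 * p1 ^ 3 * q1 * q2 ^ 2
      + 180 * f2 * p1 ^ 2 * q1 ^ 2 * p2 * q2
      + 60 * f2 * p1 * q1 ^ 3 * p2 ^ 2
      + 20 * f3 * p1 ^ 3 * q2 ^ 3
      + 180 * f3 * p1 ^ 2 * q1 * p2 * q2 ^ 2
      + 180 * f3 * p1 * q1 ^ 2 * p2 ^ 2 * q2
      + 20 * f3 * q1 ^ 3 * p2 ^ 3
      + 60 * f4 * p1 ^ 2 * p2 * q2 ^ 3
      + 180 * f4 * p1 * q1 * p2 ^ 2 * q2 ^ 2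
      + 60 * f4 * q1 ^ 2 * p2 ^ 3 * q2
      + 60 * f5 * p1 * p2 ^ 2 * q2 ^ 3
      + 60 * f5 * q1 * p2 ^ 3 * q2 ^ 2
      + 20 * f6 * p2 ^ 3 * q2 ^ 3
      - (20 * c) := ⟨_, rfl⟩
  obtain ⟨c4, hc4⟩ : ∃ z : ℂ, z = 15 * f0 * p1 ^ 2 * q1 ^ 4
      + 60 * f1 * p1 ^ 2 * q1 ^ 3 * q2
      + 30 * f1 * p1 * q1 ^ 4 * p2
      + 90 * f2 * p1 ^ 2 * q1 ^ 2 * q2 ^ 2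
      + 120 * f2 * p1 * q1 ^ 3 * p2 * q2
      + 15 * f2 * q1 ^ 4 * p2 ^ 2
      + 60 * f3 * p1 ^ 2 * q1 * q2 ^ 3
      + 180 * f3 * p1 * q1 ^ 2 * p2 * q2 ^ 2
      + 60 * f3 * q1 ^ 3 * p2 ^ 2 * q2
      + 15 * f4 * p1 ^ 2 * q2 ^ 4
      + 120 * f4 * p1 * q1 * p2 * q2 ^ 3
      + 90 * f4 * q1 ^ 2 * p2 ^ 2 * q2 ^ 2
      + 30 * f5 * p1 * p2 * q2 ^ 4
      + 60 * f5 * q1 * p2 ^ 2 * q2 ^ 3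
      + 15 * f6 * p2 ^ 2 * q2 ^ 4
      - (15 * c - 5 * d) := ⟨_, rfl⟩
  obtain ⟨c5, hc5⟩ : ∃ z : ℂ, z = 6 * f0 * p1 * q1 ^ 5
      + 30 * f1 * p1 * q1 ^ 4 * q2
      + 6 * f1 * q1 ^ 5 * p2
      + 60 * f2 * p1 * q1 ^ 3 * q2 ^ 2
      + 30 * f2 * q1 ^ 4 * p2 * q2
      + 60 * f3 * p1 * q1 ^ 2 * q2 ^ 3
      + 60 * f3 * q1 ^ 3 * p2 * q2 ^ 2
      + 30 * f4 * p1 * q1 * q2 ^ 4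
      + 60 * f4 * q1 ^ 2 * p2 * q2 ^ 3
      + 6 * f5 * p1 * q2 ^ 5
      + 30 * f5 * q1 * p2 * q2 ^ 4
      + 6 * f6 * p2 * q2 ^ 5
      - (6 * c - 2 * d) := ⟨_, rfl⟩
  obtain ⟨c6, hc6⟩ : ∃ z : ℂ, z = 1 * f0 * q1 ^ 6
      + 6 * f1 * q1 ^ 5 * q2
      + 15 * f2 * q1 ^ 4 * q2 ^ 2
      + 20 * f3 * q1 ^ 3 * q2 ^ 3
      + 15 * f4 * q1 ^ 2 * q2 ^ 4
      + 6 * f5 * q1 * q2 ^ 5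
      + 1 * f6 * q2 ^ 6
      - (b + c) := ⟨_, rfl⟩
  obtain ⟨A1, A2, A3, A4, A5⟩ := coeffs_zero (c0 := c0) (c1 := c1) (c2 := c2) (c3 := c3)
    (c4 := c4) (c5 := c5) (c6 := c6) (fun s t => by
      rw [hc0, hc1, hc2, hc3, hc4, hc5, hc6]
      linear_combination h s t)
  rw [hc1] at A1
  rw [hc2] at A2
  rw [hc3] at A3
  rw [hc4] at A4
  rw [hc5] at A5
  have hD3 : (p1 * q2 - p2 * q1) ^ 3 ≠ 0 := pow_ne_zero 3 hD
  obtain ⟨l, hl⟩ : ∃ l : ℂ, l * (p1 * q2 - p2 * q1) ^ 3 = d := ⟨_, div_mul_cancel₀ d hD3⟩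
  refine ⟨l, p1 * q1 * (p1 - q1),
    p1 * q1 * (p2 - q2) + (p1 * q2 + p2 * q1) * (p1 - q1),
    p2 * q2 * (p1 - q1) + (p1 * q2 + p2 * q1) * (p2 - q2), p2 * q2 * (p2 - q2),
    ?_, ?_, ?_, ?_, ?_⟩
  · apply mul_right_cancel₀ hD3
    linear_combination q2 ^ 3 * (A1 / 6 - A2 / 15) - 3 * q2 ^ 2 * p2 * (A2 / 15 - A3 / 20)
      + 3 * q2 * p2 ^ 2 * (A3 / 20 - A4 / 15) - p2 ^ 3 * (A4 / 15 - A5 / 6)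
      - (p2 * q2 * (p2 - q2)) * hl
  · apply mul_right_cancel₀ hD3
    linear_combination 3 * (-q2 ^ 2 * q1 * (A1 / 6 - A2 / 15)
      + (q2 ^ 2 * p1 + 2 * q1 * q2 * p2) * (A2 / 15 - A3 / 20)
      - (p2 ^ 2 * q1 + 2 * p1 * p2 * q2) * (A3 / 20 - A4 / 15)
      + p2 ^ 2 * p1 * (A4 / 15 - A5 / 6))
      + (p2 * q2 * (p1 - q1) + (p1 * q2 + p2 * q1) * (p2 - q2)) * hl
  · apply mul_right_cancel₀ hD3
    linear_combination 3 * (q1 ^ 2 * q2 * (A1 / 6 - A2 / 15)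
      - (q1 ^ 2 * p2 + 2 * q1 * q2 * p1) * (A2 / 15 - A3 / 20)
      + (p1 ^ 2 * q2 + 2 * p1 * p2 * q1) * (A3 / 20 - A4 / 15)
      - p1 ^ 2 * p2 * (A4 / 15 - A5 / 6))
      - (p1 * q1 * (p2 - q2) + (p1 * q2 + p2 * q1) * (p1 - q1)) * hl
  · apply mul_right_cancel₀ hD3
    linear_combination -q1 ^ 3 * (A1 / 6 - A2 / 15) + 3 * q1 ^ 2 * p1 * (A2 / 15 - A3 / 20)
      - 3 * q1 * p1 ^ 2 * (A3 / 20 - A4 / 15) + p1 ^ 3 * (A4 / 15 - A5 / 6)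
      + (p1 * q1 * (p1 - q1)) * hl
  · have : (p1 * q2 - p2 * q1) ^ 6 ≠ 0 := pow_ne_zero 6 hD
    intro h0
    apply this
    rw [← h0]
    ring

/-- From a Sylvester form equivalent to `Q` to a functional identity. -/
lemma reduce {Q S : MvPolynomial (Fin 2) ℂ} (hS : IsSylvester S) (hL : LinEquiv Q S) :
    ∃ a b c d p1 p2 q1 q2 : ℂ, p1 * q2 - p2 * q1 ≠ 0 ∧
      ∀ s t : ℂ, eval ![s * p1 + t * q1, s * p2 + t * q2] Q
      = a * s ^ 6 + b * t ^ 6 + c * (s + t) ^ 6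
        + d * (2 * s ^ 5 * t + 5 * s ^ 4 * t ^ 2 - 5 * s ^ 2 * t ^ 4 - 2 * s * t ^ 5) := by
  obtain ⟨a, b, c, d, u, v, w, hu, hv, -, hsum, hi, -, -, rfl⟩ := hS
  obtain ⟨M, hM, hQ⟩ := hL
  obtain ⟨u1, u2, rfl⟩ := linear_of_homog hu
  obtain ⟨v1, v2, rfl⟩ := linear_of_homog hv
  have hδ := det_ne hi
  obtain rfl := eq_neg_of_add_eq_zero_right hsum
  have hM' : M 0 0 * M 1 1 - M 0 1 * M 1 0 ≠ 0 := by
    rw [← Matrix.det_fin_two]; exact hM.ne_zero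
  set δ := u1 * v2 - u2 * v1 with hδd
  refine ⟨a, b, c, d, (M 0 0 * v2 - M 0 1 * v1) / δ, (M 1 0 * v2 - M 1 1 * v1) / δ,
    (M 0 1 * u1 - M 0 0 * u2) / δ, (M 1 1 * u1 - M 1 0 * u2) / δ, ?_, ?_⟩
  · have : (M 0 0 * v2 - M 0 1 * v1) / δ * ((M 1 1 * u1 - M 1 0 * u2) / δ) -
        (M 1 0 * v2 - M 1 1 * v1) / δ * ((M 0 1 * u1 - M 0 0 * u2) / δ)
        = (M 0 0 * M 1 1 - M 0 1 * M 1 0) / δ := by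
      field_simp
      rw [hδd]
      ring
    rw [this]
    exact div_ne_zero hM' hδ
  · intro s t
    have hx := congrArg (eval ![(v2 * s - u2 * t) / δ, (u1 * t - v1 * s) / δ]) hQ
    have e1 : u1 * ((v2 * s - u2 * t) / δ) + u2 * ((u1 * t - v1 * s) / δ) = s := by
      field_simp
      rw [hδd]
      ring
    have e2 : v1 * ((v2 * s - u2 * t) / δ) + v2 * ((u1 * t - v1 * s) / δ) = t := by
      field_simp
      rw [hδd]
      ring
    simp only [map_add, map_mul, map_pow, map_sub, map_neg, eval_C, eval_X,
      Matrix.cons_val_zero, Matrix.cons_val_one, e1, e2] at hx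
    have hsub : eval ![(v2 * s - u2 * t) / δ, (u1 * t - v1 * s) / δ] (substMat M Q)
        = eval ![s * ((M 0 0 * v2 - M 0 1 * v1) / δ) + t * ((M 0 1 * u1 - M 0 0 * u2) / δ),
            s * ((M 1 0 * v2 - M 1 1 * v1) / δ) + t * ((M 1 1 * u1 - M 1 0 * u2) / δ)] Q := by
      unfold substMat
      rw [← MvPolynomial.bind₁, MvPolynomial.eval, MvPolynomial.eval₂Hom_bind₁]
      congr 2
      funext i
      fin_cases i <;> simp <;> ring
    rw [← hsub, hx]
    ring

/-- Discriminant obstruction for all sextics with given normalized coefficients. -/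
lemma obstruct (f0 f1 f2 f3 f4 f5 f6 : ℂ) {Q S : MvPolynomial (Fin 2) ℂ}
    (hQ : ∀ x y : ℂ, eval ![x, y] Q = f0 * x ^ 6 + 6 * f1 * x ^ 5 * y + 15 * f2 * x ^ 4 * y ^ 2
      + 20 * f3 * x ^ 3 * y ^ 3 + 15 * f4 * x ^ 2 * y ^ 4 + 6 * f5 * x * y ^ 5 + f6 * y ^ 6)
    (hf : ∀ l t0 t1 t2 t3 : ℂ,
      f0 * t0 + f1 * t1 + f2 * t2 + f3 * t3 = l * t3 →
      3 * (f1 * t0 + f2 * t1 + f3 * t2 + f4 * t3) = -l * t2 →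
      3 * (f2 * t0 + f3 * t1 + f4 * t2 + f5 * t3) = l * t1 →
      f3 * t0 + f4 * t1 + f5 * t2 + f6 * t3 = -l * t0 →
      t1 ^ 2 * t2 ^ 2 - 4 * t0 * t2 ^ 3 - 4 * t1 ^ 3 * t3 + 18 * t0 * t1 * t2 * t3
        - 27 * t0 ^ 2 * t3 ^ 2 = 0)
    (hS : IsSylvester S) (hL : LinEquiv Q S) : False := by
  obtain ⟨a, b, c, d, p1, p2, q1, q2, hD, h⟩ := reduce hS hL
  obtain ⟨l, t0, t1, t2, t3, h1, h2, h3, h4, h5⟩ := core hD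
    (fun s t => (hQ _ _).symm.trans (h s t))
  exact h5 (hf l t0 t1 t2 t3 h1 h2 h3 h4)

/-- The eigenvector computation for the last sextic. -/
lemma last_case (l t0 t1 t2 t3 : ℂ)
    (h1 : 184 * t0 - 32 * t1 - 20 * t2 - 16 * t3 = l * t3)
    (h2 : 96 * t0 + 60 * t1 + 48 * t2 + 30 * t3 = l * t2)
    (h3 : -60 * t0 - 48 * t1 - 30 * t2 - 24 * t3 = l * t1)
    (h4 : 16 * t0 + 10 * t1 + 8 * t2 - 23 * t3 = l * t0) :
    t1 ^ 2 * t2 ^ 2 - 4 * t0 * t2 ^ 3 - 4 * t1 ^ 3 * t3 + 18 * t0 * t1 * t2 * t3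
        - 27 * t0 ^ 2 * t3 ^ 2 = 0 := by
  have k2 : -3808 * t0 + 896 * t1 + 672 * t2 = l ^ 2 * t0 := by
    linear_combination l * h4 + 16 * h4 + 10 * h3 + 8 * h2 - 23 * h1
  have k3 : -50176 * t0 - 40768 * t1 - 25088 * t2 + 86240 * t3 = l ^ 3 * t0 := by
    linear_combination l * k2 - 3808 * h4 + 896 * h3 + 672 * h2
  have k4 : (l ^ 4 + 3136 * l ^ 2 - 3161088) * t0 = 0 := by
    linear_combination -l * k3 + 50176 * h4 + 40768 * h3 + 25088 * h2 - 86240 * h1 - 3136 * k2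
  have e1 : t1 = t0 * (23 / 6 - 55 / 144 * l + 1 / 1344 * l ^ 2 - 23 / 225792 * l ^ 3) := by
    linear_combination (-55 / 144) * h4 + (1 / 1344) * k2 - (23 / 225792) * k3
  have e2 : t2 = t0 * (5 / 9 + 55 / 108 * l + 1 / 2016 * l ^ 2 + 23 / 169344 * l ^ 3) := by
    linear_combination (55 / 108) * h4 + (1 / 2016) * k2 + (23 / 169344) * k3
  have e3 : t3 = t0 * (23 / 9 - 7 / 216 * l + 1 / 2016 * l ^ 2 + 1 / 338688 * l ^ 3) := by
    linear_combination (-7 / 216) * h4 + (1 / 2016) * k2 + (1 / 338688) * k3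
  rw [e1, e2, e3]
  linear_combination t0 ^ 3 * ((38701 / 188116992) * l ^ 0
    + (-1340747 / 15801827328) * l ^ 1
    + (50186323 / 5309413982208) * l ^ 2
    + (-182419 / 3539609321472) * l ^ 3
    + (442403 / 56633749143552) * l ^ 4
    + (-35263 / 5550107416068096) * l ^ 5
    + (193867 / 88801718657089536) * l ^ 6
    + (529 / 1243224061199253504) * l ^ 7
    + (12167 / 59674754937564168192) * l ^ 8) * k4

end SylvesterAux

/-- None of the seven exceptional binary sextics is linearly equivalent to a
sextic in Sylvester Canonical Form. -/
theorem exceptional_sextics_not_sylvester :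
    ∀ i : Fin 7, ¬ ∃ S, IsSylvester S ∧ LinEquiv (exceptionalSextic i) S := by
  intro i
  rintro ⟨S, hS, hL⟩
  fin_cases i
  · refine SylvesterAux.obstruct 0 0 (1 / 15) 0 0 0 0 ?_ ?_ hS hL
    · intro x y
      simp [exceptionalSextic]
      try ring
    · intro l t0 t1 t2 t3 h1 h2 h3 h4
      grind
  · refine SylvesterAux.obstruct 1 0 (1 / 15) 0 0 0 0 ?_ ?_ hS hL
    · intro x y
      simp [exceptionalSextic]
      try ring
    · intro l t0 t1 t2 t3 h1 h2 h3 h4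
      grind
  · refine SylvesterAux.obstruct 0 0 0 (1 / 20) 0 0 0 ?_ ?_ hS hL
    · intro x y
      simp [exceptionalSextic]
      try ring
    · intro l t0 t1 t2 t3 h1 h2 h3 h4
      grind
  · refine SylvesterAux.obstruct 0 (1 / 6) 0 0 0 0 0 ?_ ?_ hS hL
    · intro x y
      simp [exceptionalSextic]
      try ring
    · intro l t0 t1 t2 t3 h1 h2 h3 h4
      grind
  · refine SylvesterAux.obstruct 1 0 0 0 0 (1 / 6) 0 ?_ ?_ hS hL
    · intro x y
      simp [exceptionalSextic]
      try ring
    · intro l t0 t1 t2 t3 h1 h2 h3 h4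
      grind
  · refine SylvesterAux.obstruct 2 3 0 (1 / 2) 0 0 (-1) ?_ ?_ hS hL
    · intro x y
      simp [exceptionalSextic]
      try ring
    · intro l t0 t1 t2 t3 h1 h2 h3 h4
      grind
  · refine SylvesterAux.obstruct 184 (-32) (-20) (-16) (-10) (-8) 23 ?_ ?_ hS hL
    · intro x y
      simp [exceptionalSextic]
      try ring
    · intro l t0 t1 t2 t3 h1 h2 h3 h4
      exact SylvesterAux.last_case l t0 t1 t2 t3 (by linear_combination h1)
        (by linear_combination -h2) (by linear_combination h3) (by linear_combination -h4)
end

section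
/- Let m ≥ 2 and n ≥ 3, and let Q1, Q2 ∈ X_m^n be two forms that are not linearly equivalent (i.e., there is no C ∈ GL(m,ℂ) with Q1(C·z) = Q2(z) as polynomials). Then there exist relative classical invariants I and I' of forms of degree n on ℂ^m, of equal weight, such that I'(Q1) ≠ 0, I'(Q2) ≠ 0, and I(Q1)·I'(Q2) ≠ I(Q2)·I'(Q1). In other words, the GL(m,ℂ)-orbits in X_m^n are separated by absolute classical invariants. -/
open MvPolynomial

/-- The polynomial obtained from `Q(z)` by the linear change of variables `z ↦ M z`;
its value at `w` is `Q (M w)`. -/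
noncomputable def substMatM (m : ℕ) (M : Matrix (Fin m) (Fin m) ℂ)
    (Q : MvPolynomial (Fin m) ℂ) : MvPolynomial (Fin m) ℂ :=
  aeval (fun i => ∑ j, MvPolynomial.C (M i j) * X j) Q

/-- A relative classical invariant of weight `k` of forms of degree `n` on `ℂ^m`: a function
`I` on polynomials that is a polynomial function of the coefficients and satisfies
`I(Q) = (det C)^k · I(Q_C)` for every degree-`n` form `Q` and every `C ∈ GL(m,ℂ)`, where
`Q_C(w) = Q(C⁻¹ w)`. -/
def IsRelInvariant (m n k : ℕ) (I : MvPolynomial (Fin m) ℂ → ℂ) : Prop :=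
  (∃ P : MvPolynomial ((Fin m) →₀ ℕ) ℂ,
      ∀ Q : MvPolynomial (Fin m) ℂ, I Q = eval (fun d => Q.coeff d) P) ∧
  (∀ Q : MvPolynomial (Fin m) ℂ, Q.IsHomogeneous n →
      ∀ C : Matrix (Fin m) (Fin m) ℂ, IsUnit C.det →
        I Q = C.det ^ k * I (substMatM m C⁻¹ Q))

/-- Linear substitution over a general ring. -/
noncomputable def sb {R : Type*} [CommRing R] {m : ℕ} (M : Matrix (Fin m) (Fin m) R) :
    MvPolynomial (Fin m) R →ₐ[R] MvPolynomial (Fin m) R :=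
  aeval (fun i => ∑ j, MvPolynomial.C (M i j) * X j)

section sbsec
variable {R S : Type*} [CommRing R] [CommRing S] {m : ℕ}

lemma sb_X (M : Matrix (Fin m) (Fin m) R) (i : Fin m) :
    sb M (X i) = ∑ j, MvPolynomial.C (M i j) * X j := by
  simp [sb]

lemma sb_mul (M N : Matrix (Fin m) (Fin m) R) (F : MvPolynomial (Fin m) R) :
    sb M (sb N F) = sb (N * M) F := by
  rw [← AlgHom.comp_apply]
  congr 1
  ext1 i
  simp only [AlgHom.comp_apply, sb_X, map_sum, map_mul, algHom_C, Matrix.mul_apply,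
    Finset.mul_sum, Finset.sum_mul, algebraMap_eq]
  rw [Finset.sum_comm]
  simp [mul_assoc]

lemma sb_one (F : MvPolynomial (Fin m) R) : sb (1 : Matrix (Fin m) (Fin m) R) F = F := by
  have : sb (1 : Matrix (Fin m) (Fin m) R) = AlgHom.id R _ := by
    ext1 i
    simp [sb_X, Matrix.one_apply]
  rw [this]; rfl

lemma sb_map (f : R →+* S) (M : Matrix (Fin m) (Fin m) R) (F : MvPolynomial (Fin m) R) :
    map f (sb M F) = sb (M.map f) (map f F) := by
  induction F using MvPolynomial.induction_on with
  | C a => simp [sb]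
  | add p q hp hq => simp [hp, hq]
  | mul_X p i hp => simp [hp, sb_X]

lemma sb_homog (M : Matrix (Fin m) (Fin m) R) {F : MvPolynomial (Fin m) R} {n : ℕ}
    (hF : F.IsHomogeneous n) : (sb M F).IsHomogeneous n := by
  have := hF.aeval (fun i => ∑ j, MvPolynomial.C (M i j) * X j) (n := 1)
    (fun i => IsHomogeneous.sum _ _ _ (fun j _ => isHomogeneous_C_mul_X _ _))
  simpa [sb] using this

lemma pderiv_sb (M : Matrix (Fin m) (Fin m) R) (F : MvPolynomial (Fin m) R) (j : Fin m) :
    pderiv j (sb M F) = ∑ i, MvPolynomial.C (M i j) * sb M (pderiv i F) := by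
  induction F using MvPolynomial.induction_on with
  | C a => simp [sb]
  | add p q hp hq => simp [hp, hq, mul_add, Finset.sum_add_distrib]
  | mul_X p i hp =>
    have h1 : pderiv j (sb M (X i)) = MvPolynomial.C (M i j) := by
      simp [sb_X, pderiv_X, Pi.single_apply]
    simp only [map_mul, Derivation.leibniz, hp, h1, map_add, smul_eq_mul, pderiv_X, mul_add,
      Finset.sum_add_distrib, Finset.mul_sum]
    congr 1
    · simp [Pi.single_apply, mul_comm]
    · refine Finset.sum_congr rfl fun k _ => by ring

lemma coeff_sb_diagonal (D : Fin m → R) (F : MvPolynomial (Fin m) R) (d : Fin m →₀ ℕ) :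
    coeff d (sb (Matrix.diagonal D) F) = (∏ i, D i ^ d i) * coeff d F := by
  induction F using MvPolynomial.induction_on' with
  | monomial e a =>
    have : sb (Matrix.diagonal D) (monomial e a) = monomial e ((∏ i, D i ^ e i) * a) := by
      rw [sb, aeval_monomial, Finsupp.prod_fintype _ _ (by simp)]
      simp only [Matrix.diagonal_apply, apply_ite, map_zero, ite_mul, zero_mul, Finset.sum_ite_eq,
        Finset.mem_univ, if_true, mul_pow, Finset.prod_mul_distrib, algebraMap_eq]
      rw [monomial_eq, Finsupp.prod_fintype _ _ (by simp)]
      simp only [map_mul, map_prod, map_pow]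
      ring
    rw [this, coeff_monomial, coeff_monomial]
    split_ifs with h <;> simp [h]
  | add p q hp hq => simp [hp, hq, mul_add]

end sbsec

/-! Krull -/
section krull
variable (κ : Type*) [Field κ] (m : ℕ)

noncomputable def flagHom (k : ℕ) : MvPolynomial (Fin m) κ →ₐ[κ] MvPolynomial (Fin m) κ :=
  aeval (fun i => if i.val < k then 0 else X i)

lemma height_flag (k : ℕ) (hk : k ≤ m) : (k : ℕ∞) ≤ (RingHom.ker (flagHom κ m k)).height := by
  induction k with
  | zero => simp
  | succ k ih =>
    have h1 := ih (by omega)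
    have : RingHom.ker (flagHom κ m k) < RingHom.ker (flagHom κ m (k+1)) := by
      refine lt_of_le_of_ne ?_ ?_
      · intro x hx
        rw [RingHom.mem_ker] at hx ⊢
        have : flagHom κ m (k+1) = (flagHom κ m (k+1)).comp (flagHom κ m k) := by
          ext1 i
          by_cases hi : i.val < k
          · simp [flagHom, hi, hi.le]
          · simp [flagHom, hi]
        rw [this, AlgHom.comp_apply, hx, map_zero]
      · intro h
        have : (X ⟨k, by omega⟩ : MvPolynomial (Fin m) κ) ∈ RingHom.ker (flagHom κ m (k+1)) := by
          simp [RingHom.mem_ker, flagHom]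
        rw [← h] at this
        simp [RingHom.mem_ker, flagHom] at this
    have i1 : (RingHom.ker (flagHom κ m k)).IsPrime := RingHom.ker_isPrime _
    have i2 : (RingHom.ker (flagHom κ m (k+1))).IsPrime := RingHom.ker_isPrime _
    have h2 := Ideal.height_add_one_le_of_lt_of_isPrime this
    push_cast
    exact le_trans (by gcongr) h2

lemma ker_flag_eq : RingHom.ker (flagHom κ m m) =
    RingHom.ker (constantCoeff : MvPolynomial (Fin m) κ →+* κ) := by
  have : (flagHom κ m m : MvPolynomial (Fin m) κ →+* MvPolynomial (Fin m) κ)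
      = (C : κ →+* MvPolynomial (Fin m) κ).comp constantCoeff := by
    ext i <;> simp [flagHom]
  ext x
  have h2 : flagHom κ m m x = C (constantCoeff x) := by
    simpa using congrArg (fun f => f x) this
  simp [RingHom.mem_ker, h2]

lemma krull_count (s : Finset (MvPolynomial (Fin m) κ))
    (h0 : ∀ f ∈ s, constantCoeff f = 0)
    (h1 : ∀ i, (X i : MvPolynomial (Fin m) κ) ∈ (Ideal.span (s : Set (MvPolynomial (Fin m) κ))).radical) :
    m ≤ s.card := by
  set M := RingHom.ker (constantCoeff : MvPolynomial (Fin m) κ →+* κ) with hM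
  have hmax : M.IsPrime := RingHom.ker_isPrime _
  have hmin : M ∈ (Ideal.span (s : Set (MvPolynomial (Fin m) κ))).minimalPrimes := by
    refine ⟨⟨hmax, Ideal.span_le.2 fun f hf => h0 f hf⟩, ?_⟩
    rintro P ⟨hP, hP2⟩ -
    have hX : ∀ i, (X i : MvPolynomial (Fin m) κ) ∈ P := fun i =>
      (hP.radical_le_iff.2 hP2) (h1 i)
    intro x hx
    have : idealOfVars (Fin m) κ ≤ P := by
      rw [idealOfVars, Ideal.span_le]
      rintro _ ⟨i, rfl⟩
      exact hX i
    apply this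
    rw [hM, RingHom.mem_ker] at hx
    have := mem_pow_idealOfVars_iff (σ := Fin m) (R := κ) 1 x
    rw [pow_one] at this
    rw [this]
    intro d hd
    by_contra hcon
    have hd0 : d = 0 := by
      ext i
      have := Finsupp.degree_eq_zero_iff d
      simp only [not_le, Nat.lt_one_iff] at hcon
      rw [this.1 hcon]
    subst hd0
    simp [constantCoeff_eq] at hx
    simp [hx] at hd
  have h2 := Ideal.height_le_card_of_mem_minimalPrimes_span_finset hmin
  have h3 := height_flag κ m m le_rfl
  rw [ker_flag_eq] at h3
  exact_mod_cast h3.trans h2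
end krull

/-! Combinatorics -/
lemma hall_comb {Γ : Type*} [AddCommGroup Γ] [LinearOrder Γ] [IsOrderedAddMonoid Γ]
    {m n : ℕ} (hn : 3 ≤ n) (w : Fin m → Γ)
    (h : ∀ r, 0 < w r → (Finset.univ.filter fun i => w r ≤ w i).card ≤
      (Finset.univ.filter fun j => w j + (n-1) • w r ≤ 0).card)
    (hs : 0 ≤ ∑ i, w i) : ∀ i, w i ≤ 0 := by
  classical
  by_contra hcon
  push Not at hcon
  obtain ⟨i0, hi0⟩ := hcon
  let N := {i : Fin m // 0 < w i}
  let t : N → Finset (Fin m) := fun r => Finset.univ.filter fun j => w j + (n-1) • w r.1 ≤ 0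
  have hall : ∀ s : Finset N, s.card ≤ (s.biUnion t).card := by
    intro s
    rcases s.eq_empty_or_nonempty with rfl | hne
    · simp
    obtain ⟨r, hr, hmin⟩ := s.exists_min_image (fun i => w i.1) hne
    calc s.card = (s.map (Function.Embedding.subtype _)).card := by simp
      _ ≤ (Finset.univ.filter fun i => w r.1 ≤ w i).card := by
        apply Finset.card_le_card
        intro i hi
        simp only [Finset.mem_map, Function.Embedding.subtype_apply] at hi
        obtain ⟨a, ha, rfl⟩ := hi
        simpa using hmin a ha
      _ ≤ (t r).card := h r.1 r.2
      _ ≤ _ := Finset.card_le_card (Finset.subset_biUnion_of_mem t hr)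
  obtain ⟨φ, hφ, hφ2⟩ := (Finset.all_card_le_biUnion_card_iff_exists_injective t).1 hall
  have hφ3 : ∀ r : N, w (φ r) + (n-1) • w r.1 ≤ 0 := fun r => by simpa [t] using hφ2 r
  have hle : ∀ r : N, w (φ r) + w r.1 < 0 := by
    intro r
    have : 0 < (n-2) • w r.1 := nsmul_pos r.2 (by omega)
    have h2 : (n-1) • w r.1 = (n-2) • w r.1 + w r.1 := by
      rw [← succ_nsmul]; congr 1; omega
    have := hφ3 r
    rw [h2] at this
    calc w (φ r) + w r.1 < w (φ r) + ((n-2) • w r.1 + w r.1) := by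
          rw [← add_assoc]; gcongr; simpa using ‹0 < (n-2) • w r.1›
      _ ≤ 0 := this
  have hneg : ∀ r : N, w (φ r) < 0 := fun r => lt_of_le_of_lt (by simpa using r.2.le) (hle r)
  -- split the sum
  have hsum : ∑ i, w i ≤ ∑ r : N, (w (φ r) + w r.1) := by
    rw [Finset.sum_add_distrib]
    have e1 : ∑ r : N, w r.1 = ∑ i ∈ Finset.univ.filter (fun i => 0 < w i), w i := by
      rw [← Finset.sum_subtype_eq_sum_filter]; simp [N]
    have e2 : ∑ r : N, w (φ r) = ∑ j ∈ Finset.univ.image φ, w j := by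
      rw [Finset.sum_image (fun a _ b _ h => hφ h)]
    rw [e1, e2, ← Finset.sum_filter_add_sum_filter_not Finset.univ (fun i => 0 < w i) w, add_comm]
    gcongr 1
    apply Finset.sum_le_sum_of_subset_of_nonpos'
    · intro j hj
      obtain ⟨r, -, rfl⟩ := Finset.mem_image.1 hj
      simpa using (hneg r).le
    · intro i hi _
      simpa using hi
  have : ∑ r : N, (w (φ r) + w r.1) < 0 := by
    apply Finset.sum_neg (fun r _ => hle r) ⟨⟨i0, hi0⟩, Finset.mem_univ _⟩
  exact absurd hs (not_le.2 (lt_of_le_of_lt hsum this))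

lemma hall_comb_mul {Γ : Type*} [CommGroup Γ] [LinearOrder Γ] [IsOrderedMonoid Γ]
    {m n : ℕ} (hn : 3 ≤ n) (w : Fin m → Γ)
    (h : ∀ r, 1 < w r → (Finset.univ.filter fun i => w r ≤ w i).card ≤
      (Finset.univ.filter fun j => w j * w r ^ (n-1) ≤ 1).card)
    (hs : 1 ≤ ∏ i, w i) : ∀ i, w i ≤ 1 :=
  hall_comb (Γ := Additive Γ) hn (fun i => Additive.ofMul (w i)) h hs

lemma nonsing_count {κ : Type*} [Field κ] {m n : ℕ} (hn : 2 ≤ n) (F : MvPolynomial (Fin m) κ)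
    (hF : F.IsHomogeneous n)
    (h : ∀ i, (X i : MvPolynomial (Fin m) κ) ∈
      (Ideal.span (Set.range fun j => pderiv j F)).radical)
    (S J : Finset (Fin m))
    (hJ : ∀ j d, d.support ⊆ S → coeff (d + Finsupp.single j 1) F ≠ 0 → j ∈ J) :
    S.card ≤ J.card := by
  classical
  set s : Finset (MvPolynomial (Fin m) κ) :=
    J.image (fun j => pderiv j F) ∪ Sᶜ.image (fun i => X i) with hs
  have hc : s.card ≤ J.card + (m - S.card) := by
    refine (Finset.card_union_le _ _).trans (add_le_add Finset.card_image_le ?_)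
    refine Finset.card_image_le.trans ?_
    simp [Finset.card_compl]
  have hm : m ≤ s.card := by
    apply krull_count κ m s
    · intro f hf
      simp only [hs, Finset.mem_union, Finset.mem_image] at hf
      rcases hf with ⟨j, _, rfl⟩ | ⟨i, _, rfl⟩
      · rw [constantCoeff_eq]
        apply (hF.pderiv (i := j)).coeff_eq_zero
        simp; omega
      · simp
    · intro i
      have hle : Ideal.span (Set.range fun j => pderiv j F) ≤ Ideal.span (s : Set _) := by
        rw [Ideal.span_le]
        rintro _ ⟨j, rfl⟩
        by_cases hj : j ∈ J
        · exact Ideal.subset_span (by simp [hs]; exact Or.inl ⟨j, hj, rfl⟩)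
        · have : pderiv j F ∈ Ideal.span (X '' ((Sᶜ : Finset (Fin m)) : Set (Fin m))) := by
            rw [mem_ideal_span_X_image]
            intro d hd
            by_contra hcon
            push Not at hcon
            apply hj
            refine hJ j d ?_ ?_
            · intro i hi
              by_contra hiS
              exact (Finsupp.mem_support_iff.1 hi) (hcon i (by simpa using hiS))
            · rw [mem_support_iff, coeff_pderiv] at hd
              exact left_ne_zero_of_mul hd
          refine Ideal.span_mono ?_ this
          rintro _ ⟨i, hi, rfl⟩
          simp only [hs, Finset.coe_union, Finset.coe_image]
          exact Or.inr ⟨i, hi, rfl⟩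
      exact Ideal.radical_mono hle (h i)
  have : S.card ≤ m := by simpa using S.card_le_univ
  omega

section smith
variable {K : Type*} [Field K] (V : ValuationSubring K)

lemma exists_equiv_inl (n : ℕ) (i : Fin (n+1)) :
    ∃ σ : Unit ⊕ Fin n ≃ Fin (n+1), σ (Sum.inl ()) = i := by
  have e : Unit ⊕ Fin n ≃ Fin (n+1) := Fintype.equivOfCardEq (by simp [add_comm])
  exact ⟨e.trans (Equiv.swap (e (Sum.inl ())) i), by simp⟩

lemma smith (n : ℕ) (M : Matrix (Fin n) (Fin n) K) :
    ∃ A B : Matrix (Fin n) (Fin n) V, ∃ D : Fin n → K, IsUnit A ∧ IsUnit B ∧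
      M = A.map V.subtype * Matrix.diagonal D * B.map V.subtype := by
  induction n with
  | zero => exact ⟨1, 1, fun _ => 0, isUnit_one, isUnit_one, by ext i; exact i.elim0⟩
  | succ n ih =>
    obtain ⟨⟨i0, j0⟩, hmax⟩ := Finite.exists_max
      (fun ij : Fin (n+1) × Fin (n+1) => V.valuation (M ij.1 ij.2))
    simp only [Prod.forall] at hmax
    by_cases hp : M i0 j0 = 0
    · refine ⟨1, 1, fun _ => 0, isUnit_one, isUnit_one, ?_⟩
      ext i j
      have := hmax i j
      simp only [hp, map_zero, le_zero_iff, map_eq_zero] at this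
      simp [this]
    obtain ⟨σ, hσ⟩ := exists_equiv_inl n i0
    obtain ⟨τ, hτ⟩ := exists_equiv_inl n j0
    have hdiv : ∀ i j, M i j / M i0 j0 ∈ V := by
      intro i j
      rw [← V.valuation_le_one_iff, map_div₀]
      exact div_le_one_of_le₀ (hmax i j) zero_le
    set p := M i0 j0 with hpdef
    let c : Matrix (Fin n) Unit V := fun i _ => ⟨M (σ (Sum.inr i)) j0 / p, hdiv _ _⟩
    let r : Matrix Unit (Fin n) V := fun _ j => ⟨M i0 (τ (Sum.inr j)) / p, hdiv _ _⟩
    let E : Matrix (Fin n) (Fin n) K := fun i j => M (σ (Sum.inr i)) (τ (Sum.inr j)) -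
      M (σ (Sum.inr i)) j0 / p * M i0 (τ (Sum.inr j))
    obtain ⟨A, B, D, hA, hB, hE⟩ := ih E
    let A0 : Matrix (Unit ⊕ Fin n) (Unit ⊕ Fin n) V := Matrix.fromBlocks 1 0 c A
    let B0 : Matrix (Unit ⊕ Fin n) (Unit ⊕ Fin n) V := Matrix.fromBlocks 1 r 0 B
    let D0 : Unit ⊕ Fin n → K := Sum.elim (fun _ => p) D
    have hc : ∀ i u, ((c i u : V) : K) = M (σ (Sum.inr i)) j0 / p := fun _ _ => rfl
    have hr : ∀ u j, ((r u j : V) : K) = M i0 (τ (Sum.inr j)) / p := fun _ _ => rfl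
    clear_value c r
    have hA0 : IsUnit A0 := by
      rw [Matrix.isUnit_iff_isUnit_det, Matrix.det_fromBlocks_zero₁₂]
      simpa using (Matrix.isUnit_iff_isUnit_det _).1 hA
    have hB0 : IsUnit B0 := by
      rw [Matrix.isUnit_iff_isUnit_det, Matrix.det_fromBlocks_zero₂₁]
      simpa using (Matrix.isUnit_iff_isUnit_det _).1 hB
    have hM : M.submatrix σ τ = A0.map V.subtype * Matrix.diagonal D0 * B0.map V.subtype := by
      have hD0 : Matrix.diagonal D0 = Matrix.fromBlocks (Matrix.diagonal fun _ => p) 0 0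
          (Matrix.diagonal D) := by
        rw [Matrix.fromBlocks_diagonal]
      rw [hD0]
      simp only [A0, B0, Matrix.fromBlocks_map, Matrix.fromBlocks_multiply]
      ext (i | i) (j | j)
      · simp [hσ, hτ, hpdef]
      · simp only [Matrix.submatrix_apply, hσ, Matrix.fromBlocks_apply₁₂, Matrix.add_apply]
        simp [Matrix.mul_apply, hr]
        field_simp
      · simp only [Matrix.submatrix_apply, hτ, Matrix.fromBlocks_apply₂₁, Matrix.add_apply]
        simp [Matrix.mul_apply, hc]
        field_simp
      · have := congrFun (congrFun hE i) j
        simp only [E] at this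
        rw [sub_eq_iff_eq_add] at this
        simp only [Matrix.submatrix_apply, this, Matrix.fromBlocks_apply₂₂, Matrix.add_apply]
        simp [Matrix.mul_apply, hc, hr]
        field_simp
        ring
    refine ⟨A0.submatrix σ.symm σ.symm, B0.submatrix σ.symm τ.symm, D0 ∘ σ.symm, ?_, ?_, ?_⟩
    · rwa [Matrix.isUnit_submatrix_equiv]
    · rwa [Matrix.isUnit_submatrix_equiv]
    · have h1 : M = (M.submatrix σ τ).submatrix σ.symm τ.symm := by simp
      have h2 : Matrix.diagonal (D0 ∘ σ.symm) = (Matrix.diagonal D0).submatrix σ.symm σ.symm := by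
        rw [Matrix.submatrix_diagonal_equiv]
      rw [h1, hM, h2, ← Matrix.submatrix_map, ← Matrix.submatrix_map, Matrix.submatrix_mul_equiv,
        Matrix.submatrix_mul_equiv]

end smith

/-- change of variables keeps nonsingularity -/
lemma rad_sb {κ : Type*} [CommRing κ] {m : ℕ} (F : MvPolynomial (Fin m) κ)
    (h : ∀ i, (X i : MvPolynomial (Fin m) κ) ∈
      (Ideal.span (Set.range fun j => pderiv j F)).radical)
    (A B : Matrix (Fin m) (Fin m) κ) (hAB : A * B = 1) (i : Fin m) :
    (X i : MvPolynomial (Fin m) κ) ∈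
      (Ideal.span (Set.range fun j => pderiv j (sb A F))).radical := by
  have hBA : B * A = 1 := mul_eq_one_comm.1 hAB
  set J := Ideal.span (Set.range fun j => pderiv j (sb A F)) with hJ
  have h1 : ∀ k, sb A (pderiv k F) ∈ J := by
    intro k
    have : sb A (pderiv k F) = ∑ j, MvPolynomial.C (B j k) * pderiv j (sb A F) := by
      simp only [pderiv_sb, Finset.mul_sum]
      rw [Finset.sum_comm]
      simp only [← mul_assoc, ← Finset.sum_mul, ← map_mul, ← map_sum]
      have : ∀ x, ∑ j, B j k * A x j = (1 : Matrix (Fin m) (Fin m) κ) x k := by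
        intro x
        rw [← hAB, Matrix.mul_apply]
        exact Finset.sum_congr rfl fun j _ => mul_comm _ _
      simp [this, Matrix.one_apply]
    rw [this]
    exact Ideal.sum_mem _ fun j _ => Ideal.mul_mem_left _ _ (Ideal.subset_span ⟨j, rfl⟩)
  have h2 : ∀ k, sb A (X k) ∈ J.radical := by
    intro k
    obtain ⟨N, hN⟩ := h k
    refine ⟨N, ?_⟩
    rw [← map_pow]
    have : Ideal.span (Set.range fun j => pderiv j F) ≤ Ideal.comap (sb A) J := by
      rw [Ideal.span_le]
      rintro _ ⟨k, rfl⟩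
      exact h1 k
    exact this hN
  have h3 : (X i : MvPolynomial (Fin m) κ) = ∑ k, MvPolynomial.C (B i k) * sb A (X k) := by
    have : sb A (sb B (X i)) = X i := by rw [sb_mul, hBA, sb_one]
    rw [← this, sb_X B]
    simp [sb]
  rw [h3]
  exact Ideal.sum_mem _ fun j _ => Ideal.mul_mem_left _ _ (h2 j)

lemma rad_map {R κ : Type*} [CommRing R] [CommRing κ] {m : ℕ} (F : MvPolynomial (Fin m) R)
    (f : R →+* κ)
    (h : ∀ i, (X i : MvPolynomial (Fin m) R) ∈
      (Ideal.span (Set.range fun j => pderiv j F)).radical) (i : Fin m) :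
    (X i : MvPolynomial (Fin m) κ) ∈
      (Ideal.span (Set.range fun j => pderiv j (map f F))).radical := by
  obtain ⟨N, hN⟩ := h i
  refine ⟨N, ?_⟩
  have : Ideal.span (Set.range fun j => pderiv j F) ≤
      Ideal.comap (map f) (Ideal.span (Set.range fun j => pderiv j (map f F))) := by
    rw [Ideal.span_le]
    rintro _ ⟨k, rfl⟩
    apply Ideal.subset_span
    exact ⟨k, by simp [pderiv_map]⟩
  simpa using this hN

lemma rad_of_nonsing {m : ℕ} (Q : MvPolynomial (Fin m) ℂ)
    (hx : ∀ z : Fin m → ℂ, (∀ i, eval z (pderiv i Q) = 0) → z = 0) (i : Fin m) :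
    (X i : MvPolynomial (Fin m) ℂ) ∈ (Ideal.span (Set.range fun j => pderiv j Q)).radical := by
  rw [← vanishingIdeal_zeroLocus_eq_radical (K := ℂ)]
  rw [mem_vanishingIdeal_iff]
  intro z hz
  rw [mem_zeroLocus_iff] at hz
  have : z = 0 := hx z fun i => by
    simpa [coe_aeval_eq_eval] using hz _ (Ideal.subset_span ⟨i, rfl⟩)
  simp [this]

lemma exists_map_of_coeff_mem {K : Type*} [Field K] (V : ValuationSubring K) {σ : Type*}
    (F : MvPolynomial σ K) (h : ∀ d, coeff d F ∈ V) :
    ∃ H : MvPolynomial σ V, map V.subtype H = F := by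
  have : F ∈ Set.range (map (σ := σ) V.subtype) := by
    rw [mem_range_map_iff_coeffs_subset]
    intro c hc
    obtain ⟨d, -, rfl⟩ := mem_coeffs_iff.1 hc
    exact ⟨⟨_, h d⟩, rfl⟩
  exact this

lemma valuative {K : Type*} [Field K] [Algebra ℂ K] (V : ValuationSubring K)
    (hV : ∀ c : ℂ, algebraMap ℂ K c ∈ V) {m n : ℕ} (hn : 3 ≤ n) (Q : MvPolynomial (Fin m) ℂ)
    (hQ : Q.IsHomogeneous n)
    (hx : ∀ z : Fin m → ℂ, (∀ i, eval z (pderiv i Q) = 0) → z = 0)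
    (G : Matrix (Fin m) (Fin m) K) (hG : G.det ≠ 0) (hG' : (G.det)⁻¹ ∈ V)
    (hc : ∀ d, coeff d (sb G (map (algebraMap ℂ K) Q)) ∈ V) : ∀ i j, G i j ∈ V := by
  classical
  let ι : ℂ →+* V := (algebraMap ℂ K).codRestrict V.toSubring hV
  have hι : (V.subtype : V →+* K).comp ι = algebraMap ℂ K := by ext; rfl
  obtain ⟨A, B, D, hA, hB, hGD⟩ := smith V m G
  obtain ⟨A', hAA⟩ := hA.exists_right_inv
  obtain ⟨B', hBB⟩ := hB.exists_right_inv
  set F := sb A (map ι Q) with hF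
  -- coefficients of F ∘ D are in V
  have hFD : ∀ d, (∏ i, D i ^ d i) * ((coeff d F : V) : K) ∈ V := by
    intro d
    obtain ⟨H, hH⟩ := exists_map_of_coeff_mem V _ hc
    have h1 : sb (Matrix.diagonal D) (map V.subtype F) = map V.subtype (sb B' H) := by
      rw [hF, sb_map, sb_map, hH, map_map, hι, sb_mul, sb_mul, hGD, Matrix.mul_assoc _ _ (B'.map _),
        ← Matrix.map_mul, hBB]
      simp
    have h2 := congrArg (coeff d) h1
    rw [coeff_sb_diagonal, coeff_map, coeff_map] at h2
    have h3 := (coeff d (sb B' H)).2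
    have h4 : (∏ i, D i ^ d i) * ((coeff d F : V) : K) = ((coeff d (sb B' H) : V) : K) := h2
    rw [h4]; exact h3
  -- reduction
  let ρ := IsLocalRing.residue V
  have hFbar : map ρ F = sb (A.map ρ) (map (ρ.comp ι) Q) := by rw [hF, sb_map, map_map]
  have hrad := rad_sb _ (rad_map Q (ρ.comp ι) (rad_of_nonsing Q hx)) (A.map ρ) (A'.map ρ)
    (by rw [← Matrix.map_mul, hAA]; simp)
  rw [← hFbar] at hrad
  have hhom : (map ρ F).IsHomogeneous n := (sb_homog A (hQ.map ι)).map ρ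
  -- valuations
  have hdetA : V.valuation ((A.map V.subtype).det) = 1 := by
    have h1 : (A.map V.subtype).det = V.subtype A.det := (RingHom.map_det _ _).symm
    rw [h1]
    exact (V.valuation_eq_one_iff _).1 ((Matrix.isUnit_iff_isUnit_det _).1 hA)
  have hdetB : V.valuation ((B.map V.subtype).det) = 1 := by
    have h1 : (B.map V.subtype).det = V.subtype B.det := (RingHom.map_det _ _).symm
    rw [h1]
    exact (V.valuation_eq_one_iff _).1 ((Matrix.isUnit_iff_isUnit_det _).1 hB)
  have hdet : V.valuation G.det = ∏ i, V.valuation (D i) := by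
    rw [hGD, Matrix.det_mul, Matrix.det_mul, map_mul, map_mul, hdetA, hdetB, Matrix.det_diagonal,
      map_prod]
    simp
  have hprod : ∏ i, V.valuation (D i) ≠ 0 := by
    rw [← hdet]; simpa using hG
  have hD0 : ∀ i, V.valuation (D i) ≠ 0 := fun i => (Finset.prod_ne_zero_iff.1 hprod) i (by simp)
  let w : Fin m → (V.ValueGroup)ˣ := fun i => Units.mk0 _ (hD0 i)
  have hw : ∀ i, ((w i : (V.ValueGroup)ˣ) : V.ValueGroup) = V.valuation (D i) := fun i => rfl
  have hw1 : ∀ i, w i ≤ 1 := by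
    apply hall_comb_mul hn w
    · intro r hr
      apply nonsing_count (by omega : 2 ≤ n) (map ρ F) hhom hrad
      intro j d hd hcoef
      simp only [Finset.mem_filter, Finset.mem_univ, true_and]
      have hdeg : d.degree = n - 1 := by
        by_contra hne
        apply hcoef
        apply hhom.coeff_eq_zero
        simp only [map_add, Finsupp.degree_single]
        omega
      have hunit : IsUnit (coeff (d + Finsupp.single j 1) F) := by
        rw [coeff_map] at hcoef
        by_contra hnu
        exact hcoef ((IsLocalRing.residue_eq_zero_iff _).2 hnu)
      have h1 := (V.valuation_le_one_iff _).2 (hFD (d + Finsupp.single j 1))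
      rw [map_mul, (V.valuation_eq_one_iff _).1 hunit, mul_one, map_prod] at h1
      have h2 : ∏ i, w i ^ ((d + Finsupp.single j 1 : Fin m →₀ ℕ) i) ≤ 1 := by
        rw [← Units.val_le_val]
        push_cast
        simpa [hw] using h1
      refine le_trans ?_ h2
      have h3 : ∏ i, w i ^ ((d + Finsupp.single j 1 : Fin m →₀ ℕ) i) = w j * ∏ i, w i ^ d i := by
        simp only [Finsupp.add_apply, pow_add, Finset.prod_mul_distrib]
        rw [mul_comm]
        congr 1
        rw [Finset.prod_eq_single j]
        · simp
        · intro b _ hb; simp [Finsupp.single_apply, hb.symm]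
        · simp
      rw [h3]
      gcongr
      have h4 : w r ^ (n-1) = ∏ i, w r ^ d i := by
        rw [Finset.prod_pow_eq_pow_sum, ← hdeg, Finsupp.degree_eq_sum]
      rw [h4]
      apply Finset.prod_le_prod'
      intro i _
      by_cases hi : d i = 0
      · simp [hi]
      · have := hd (Finsupp.mem_support_iff.2 hi)
        simp only [Finset.mem_filter, Finset.mem_univ, true_and] at this
        exact pow_le_pow_left' this _
    · rw [← Units.val_le_val]
      push_cast
      simp only [hw]
      rw [← hdet]
      have := (V.valuation_le_one_iff _).2 hG'
      rw [map_inv₀] at this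
      exact (inv_le_one₀ (zero_lt_iff.2 (by simpa using hG))).1 this
  have hDV : ∀ i, D i ∈ V := fun i => by
    rw [← V.valuation_le_one_iff, ← hw]
    exact_mod_cast hw1 i
  intro i j
  rw [hGD, Matrix.mul_apply]
  apply sum_mem
  intro k _
  rw [Matrix.mul_diagonal]
  exact mul_mem (mul_mem (A i k).2 (hDV k)) (B k j).2

lemma lift_hom {A S : Type*} [CommRing A] [Algebra ℂ A] [CommRing S] [Algebra ℂ S] [Algebra A S]
    [IsScalarTower ℂ A S] [Algebra.IsIntegral A S]
    (x : A →ₐ[ℂ] ℂ) (h : ∀ f, algebraMap A S f = 0 → x f = 0) :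
    ∃ ψ : S →ₐ[ℂ] ℂ, ∀ f, ψ (algebraMap A S f) = x f := by
  have hxs : Function.Surjective x := fun c => ⟨algebraMap ℂ A c, by simp⟩
  have hmax : (RingHom.ker x).IsMaximal := RingHom.ker_isMaximal_of_surjective _ hxs
  obtain ⟨Q, hQ, hQx⟩ := Ideal.exists_ideal_over_maximal_of_isIntegral (S := S) (RingHom.ker x)
    (fun f hf => h f hf)
  have key : ∀ f : A, algebraMap ℂ (S ⧸ Q) (x f) = Ideal.Quotient.mk Q (algebraMap A S f) := by
    intro f
    have h1 : f - algebraMap ℂ A (x f) ∈ RingHom.ker x := by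
      rw [RingHom.mem_ker]; simp
    rw [← hQx, Ideal.mem_comap, map_sub, ← IsScalarTower.algebraMap_apply] at h1
    exact ((Ideal.Quotient.eq).2 h1).symm
  have : Algebra.IsIntegral ℂ (S ⧸ Q) := by
    constructor
    intro y
    obtain ⟨s, rfl⟩ := Ideal.Quotient.mk_surjective y
    obtain ⟨p, hp, hps⟩ := Algebra.IsIntegral.isIntegral (R := A) s
    refine ⟨p.map (x : A →+* ℂ), hp.map _, ?_⟩
    rw [Polynomial.eval₂_map]
    have h2 : (algebraMap ℂ (S ⧸ Q)).comp (x : A →+* ℂ) =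
        (Ideal.Quotient.mk Q).comp (algebraMap A S) := by
      ext f; exact key f
    rw [h2, ← Polynomial.hom_eval₂, hps, map_zero]
  have hbij := IsAlgClosed.algebraMap_bijective_of_isIntegral (k := ℂ) (K := S ⧸ Q)
  let E := AlgEquiv.ofBijective (Algebra.ofId ℂ (S ⧸ Q)) hbij
  refine ⟨(E.symm : (S ⧸ Q) →ₐ[ℂ] ℂ).comp (Ideal.Quotient.mkₐ ℂ Q), fun f => ?_⟩
  simp only [AlgHom.comp_apply, Ideal.Quotient.mkₐ_eq_mk, AlgHom.coe_coe]
  rw [← key]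
  exact E.symm_apply_apply (x f)

lemma exists_sep {σ : Type*} [Finite σ] (J1 J2 : Ideal (MvPolynomial σ ℂ))
    (h : ∀ x : σ → ℂ, (∀ f ∈ J1, eval x f = 0) → (∀ f ∈ J2, eval x f = 0) → False) :
    ∃ f ∈ J1, 1 - f ∈ J2 := by
  have : J1 ⊔ J2 = ⊤ := by
    by_contra hne
    obtain ⟨M, hM, hle⟩ := Ideal.exists_le_maximal _ hne
    obtain ⟨x, rfl⟩ := isMaximal_iff_eq_vanishingIdeal_singleton.1 hM
    refine h x (fun f hf => ?_) (fun f hf => ?_)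
    · have := hle (Ideal.mem_sup_left hf)
      simpa [mem_vanishingIdeal_singleton_iff] using this
    · have := hle (Ideal.mem_sup_right hf)
      simpa [mem_vanishingIdeal_singleton_iff] using this
  obtain ⟨a, ha, b, hb, hab⟩ := Submodule.mem_sup.1 ((Ideal.eq_top_iff_one _).1 this)
  exact ⟨a, ha, by rw [← hab]; simpa using hb⟩

/-- Exponents of degree `n`. -/
abbrev Ex (m n : ℕ) : Type := {d : Fin m →₀ ℕ // d.degree = n}

instance instFiniteEx (m n : ℕ) : Finite (Ex m n) := by
  have : ({d : Fin m →₀ ℕ | d.degree = n}).Finite := by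
    apply ((Finset.univ : Finset (Fin m)).finsuppAntidiag n).finite_toSet.subset
    intro d hd
    simp only [Finset.mem_coe, Finset.mem_finsuppAntidiag, Finset.subset_univ, and_true]
    rw [← hd, Finsupp.degree_eq_sum]
  exact this.to_subtype

/-- The point with coordinates the coefficients of `Q` and `s`. -/
noncomputable def pt {R : Type*} [CommRing R] {m : ℕ} (n : ℕ) (Q : MvPolynomial (Fin m) R) (s : R) :
    Option (Ex m n) → R :=
  fun o => o.elim s (fun d => coeff d.1 Q)

lemma pt_map {R S : Type*} [CommRing R] [CommRing S] {m n : ℕ} (Q : MvPolynomial (Fin m) R) (s : R)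
    (f : R →+* S) (o) : pt n (map f Q) (f s) o = f (pt n Q s o) := by
  cases o <;> simp [pt, coeff_map]

lemma isInt_of_val {A K : Type*} [CommRing A] [Field K] [Algebra A K] (y : K)
    (h : ∀ V : ValuationSubring K, (∀ a, algebraMap A K a ∈ V) → y ∈ V) : IsIntegral A y := by
  have h1 : y ∈ (⨅ V : {V : ValuationSubring K // ((algebraMap A K).range : Set K) ⊆ V.toSubring}, V.1.toSubring) := by
    rw [Subring.mem_iInf]
    rintro ⟨V, hV⟩
    exact h V (fun a => hV ⟨a, rfl⟩)
  rw [iInf_valuationSubring_superset] at h1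
  obtain ⟨p, hp, hpy⟩ : IsIntegral (Subring.closure ((algebraMap A K).range : Set K)) y := h1
  obtain ⟨q, hq, hqd, hqm⟩ : ∃ q : Polynomial A, q.map (algebraMap A K) = p.map (Subring.subtype _) ∧
      q.degree = (p.map (Subring.subtype _)).degree ∧ q.Monic := by
    apply Polynomial.lifts_and_degree_eq_and_monic
    · rw [Polynomial.lifts_iff_coeff_lifts]
      intro k
      have := (Subring.closure_eq (algebraMap A K).range).le (p.coeff k).2
      rw [Polynomial.coeff_map]
      exact this
    · exact hp.map _
  refine ⟨q, hqm, ?_⟩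
  rw [Polynomial.eval₂_eq_eval_map, hq, ← Polynomial.eval₂_eq_eval_map]
  exact hpy

lemma orbit_closed_aux {m n : ℕ} (hn : 3 ≤ n) (Q : MvPolynomial (Fin m) ℂ) (hQ : Q.IsHomogeneous n)
    (hx : ∀ z : Fin m → ℂ, (∀ i, eval z (pderiv i Q) = 0) → z = 0) (e : ℕ) (he : 1 ≤ e)
    (a : ℂ) (ha : a ≠ 0) (K : Type*) [Field K] [Algebra ℂ K]
    [Algebra (MvPolynomial (Option (Ex m n)) ℂ) K]
    [IsScalarTower ℂ (MvPolynomial (Option (Ex m n)) ℂ) K]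
    (G : Matrix (Fin m) (Fin m) K) (hG0 : G.det ≠ 0)
    (hsome : ∀ d : Ex m n, algebraMap (MvPolynomial (Option (Ex m n)) ℂ) K (X (some d)) =
        coeff d.1 (sb G (map (algebraMap ℂ K) Q)))
    (hnone : algebraMap (MvPolynomial (Option (Ex m n)) ℂ) K (X none) =
        algebraMap ℂ K a * (G.det⁻¹) ^ e)
    (x : Option (Ex m n) → ℂ)
    (hker : ∀ f, algebraMap (MvPolynomial (Option (Ex m n)) ℂ) K f = 0 → aeval x f = 0) :
    ∃ g : Matrix (Fin m) (Fin m) ℂ, IsUnit g.det ∧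
        x = pt n (sb g Q) (a * (g.det)⁻¹ ^ e) := by
  let S := integralClosure (MvPolynomial (Option (Ex m n)) ℂ) K
  have hC : ∀ V : ValuationSubring K,
      (∀ f, algebraMap (MvPolynomial (Option (Ex m n)) ℂ) K f ∈ V) →
      ∀ c : ℂ, algebraMap ℂ K c ∈ V := by
    intro V hV c
    rw [IsScalarTower.algebraMap_apply ℂ (MvPolynomial (Option (Ex m n)) ℂ) K]
    exact hV _
  have hdetV : ∀ V : ValuationSubring K,
      (∀ f, algebraMap (MvPolynomial (Option (Ex m n)) ℂ) K f ∈ V) → G.det⁻¹ ∈ V := by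
    intro V hV
    have h1 : (G.det⁻¹) ^ e ∈ V := by
      have h2 := mul_mem (hC V hV a⁻¹) (hV (X none))
      rw [hnone, ← mul_assoc, ← map_mul, inv_mul_cancel₀ ha, map_one, one_mul] at h2
      exact h2
    rw [← V.valuation_le_one_iff] at h1 ⊢
    rw [map_pow] at h1
    exact (pow_le_one_iff (by omega)).1 h1
  have hGint : ∀ i j, IsIntegral (MvPolynomial (Option (Ex m n)) ℂ) (G i j) := by
    intro i j
    apply isInt_of_val
    intro V hV
    refine valuative V (hC V hV) hn Q hQ hx G hG0 (hdetV V hV) ?_ i j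
    intro d
    by_cases hd : d.degree = n
    · have := hV (X (some ⟨d, hd⟩))
      rwa [hsome] at this
    · rw [(sb_homog G (hQ.map (algebraMap ℂ K))).coeff_eq_zero hd]
      exact zero_mem V
  have htint : IsIntegral (MvPolynomial (Option (Ex m n)) ℂ) G.det⁻¹ :=
    isInt_of_val _ hdetV
  obtain ⟨ψ, hψ⟩ := lift_hom (A := MvPolynomial (Option (Ex m n)) ℂ) (S := S) (aeval x) (by
    intro f hf
    exact hker f (congrArg Subtype.val hf))
  let GS : Matrix (Fin m) (Fin m) S := Matrix.of fun i j => ⟨G i j, hGint i j⟩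
  let tS : S := ⟨G.det⁻¹, htint⟩
  have hGS : GS.map (algebraMap S K) = G := by ext i j; rfl
  have hinj : Function.Injective (algebraMap S K) := Subtype.val_injective
  have hdetS : GS.det * tS = 1 := by
    apply hinj
    rw [map_mul, map_one, RingHom.map_det]
    have : (algebraMap S K).mapMatrix GS = G := hGS
    rw [this]
    exact mul_inv_cancel₀ hG0
  have hψC : (ψ : S →+* ℂ).comp (algebraMap ℂ S) = RingHom.id ℂ := by
    ext c; simp
  let g : Matrix (Fin m) (Fin m) ℂ := GS.map ψ
  have hgdet : g.det = ψ GS.det := (AlgHom.map_det ψ _).symm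
  have hgt : g.det * ψ tS = 1 := by rw [hgdet, ← map_mul, hdetS, map_one]
  refine ⟨g, IsUnit.of_mul_eq_one _ hgt, ?_⟩
  funext o
  cases o with
  | none =>
    have h1 : algebraMap (MvPolynomial (Option (Ex m n)) ℂ) S (X none) =
        algebraMap ℂ S a * tS ^ e := by
      apply hinj
      rw [map_mul, map_pow, ← IsScalarTower.algebraMap_apply, ← IsScalarTower.algebraMap_apply]
      exact hnone
    have h2 := hψ (X none)
    rw [h1, map_mul, map_pow, AlgHom.commutes, aeval_X] at h2
    rw [← h2, ← eq_inv_of_mul_eq_one_right hgt]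
    rfl
  | some d =>
    have h1 : algebraMap (MvPolynomial (Option (Ex m n)) ℂ) S (X (some d)) =
        coeff d.1 (sb GS (map (algebraMap ℂ S) Q)) := by
      apply hinj
      rw [← coeff_map, sb_map, map_map, ← IsScalarTower.algebraMap_apply,
        ← IsScalarTower.algebraMap_eq, hGS]
      exact hsome d
    have h2 := hψ (X (some d))
    rw [h1, aeval_X] at h2
    have h3 : sb g Q = map (ψ : S →+* ℂ) (sb GS (map (algebraMap ℂ S) Q)) := by
      rw [sb_map, map_map, hψC, map_id]; rfl
    show _ = coeff d.1 (sb g Q)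
    rw [h3, coeff_map, ← h2]
    rfl

theorem orbit_ideal {m n : ℕ} (hn : 3 ≤ n) (Q : MvPolynomial (Fin m) ℂ) (hQ : Q.IsHomogeneous n)
    (hx : ∀ z : Fin m → ℂ, (∀ i, eval z (pderiv i Q) = 0) → z = 0) (e : ℕ) (he : 1 ≤ e)
    (a : ℂ) (ha : a ≠ 0) :
    ∃ J : Ideal (MvPolynomial (Option (Ex m n)) ℂ),
      (∀ f ∈ J, ∀ g : Matrix (Fin m) (Fin m) ℂ, IsUnit g.det →
        eval (pt n (sb g Q) (a * (g.det)⁻¹ ^ e)) f = 0) ∧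
      (∀ x, (∀ f ∈ J, eval x f = 0) → ∃ g : Matrix (Fin m) (Fin m) ℂ, IsUnit g.det ∧
        x = pt n (sb g Q) (a * (g.det)⁻¹ ^ e)) := by
  classical
  let P := MvPolynomial (Fin m × Fin m) ℂ
  let G0 : Matrix (Fin m) (Fin m) P := Matrix.of fun i j => X (i, j)
  let Δ : P := G0.det
  have hevG (g : Matrix (Fin m) (Fin m) ℂ) : G0.map (eval fun ij => g ij.1 ij.2) = g := by
    ext i j; simp [G0]
  have hevΔ (g : Matrix (Fin m) (Fin m) ℂ) : eval (fun ij => g ij.1 ij.2) Δ = g.det := by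
    rw [RingHom.map_det]; exact congrArg _ (hevG g)
  have hΔ : Δ ≠ 0 := by
    intro h0
    have := hevΔ 1
    rw [h0] at this
    simp at this
  let B := Localization.Away Δ
  have hle : Submonoid.powers Δ ≤ nonZeroDivisors P := powers_le_nonZeroDivisors_of_noZeroDivisors hΔ
  have hdom : IsDomain B := IsLocalization.isDomain_localization hle
  let K := FractionRing B
  let t : B := IsLocalization.Away.invSelf Δ
  have ht : algebraMap P B Δ * t = 1 := IsLocalization.Away.mul_invSelf Δ
  let GB : Matrix (Fin m) (Fin m) B := G0.map (algebraMap P B)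
  have hGBdet : GB.det * t = 1 := by
    rw [← ht, RingHom.map_det]; rfl
  let φ0 : MvPolynomial (Option (Ex m n)) ℂ →ₐ[ℂ] B :=
    aeval (pt n (sb GB (map (algebraMap ℂ B) Q)) (algebraMap ℂ B a * t ^ e))
  refine ⟨RingHom.ker φ0, ?_, ?_⟩
  · intro f hf g hg
    let ev : B →+* ℂ := IsLocalization.Away.lift Δ (g := eval fun ij => g ij.1 ij.2)
      (by rw [hevΔ]; exact hg)
    have hev : ev.comp (algebraMap P B) = eval fun ij => g ij.1 ij.2 :=
      IsLocalization.Away.lift_comp Δ _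
    have hevC : ev.comp (algebraMap ℂ B) = RingHom.id ℂ := by
      ext c
      rw [IsScalarTower.algebraMap_eq ℂ P B, ← RingHom.comp_assoc, hev]
      simp [P]
    have hevt : ev t = (g.det)⁻¹ := by
      have h1 := congrArg ev ht
      rw [map_mul, map_one, ← RingHom.comp_apply, hev, hevΔ] at h1
      exact eq_inv_of_mul_eq_one_right h1
    have hpt : pt n (sb g Q) (a * (g.det)⁻¹ ^ e) =
        fun o => ev (pt n (sb GB (map (algebraMap ℂ B) Q)) (algebraMap ℂ B a * t ^ e) o) := by
      funext o
      rw [← pt_map, sb_map, map_map, hevC, map_id, map_mul, map_pow, hevt, ← RingHom.comp_apply,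
        hevC]
      have : GB.map ev = g := by
        rw [← hevG g, Matrix.map_map, ← hev]; rfl
      rw [this]; rfl
    have h2 := congrArg ev (RingHom.mem_ker.1 hf)
    rw [hpt]
    rw [map_zero] at h2
    rw [← h2]
    simp only [φ0]
    show eval _ f = (ev.comp (eval₂Hom _ _)) f
    rw [comp_eval₂Hom, hevC]
    rfl
  · intro x hxJ
    let φ : MvPolynomial (Option (Ex m n)) ℂ →ₐ[ℂ] K :=
      (IsScalarTower.toAlgHom ℂ B K).comp φ0
    letI alg : Algebra (MvPolynomial (Option (Ex m n)) ℂ) K := φ.toRingHom.toAlgebra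
    have hAK : ∀ f, φ f = algebraMap B K (φ0 f) :=
      fun f => rfl
    haveI tow : @IsScalarTower ℂ (MvPolynomial (Option (Ex m n)) ℂ) K _ alg.toSMul _ :=
      IsScalarTower.of_algebraMap_eq fun c => (φ.commutes c).symm
    let G : Matrix (Fin m) (Fin m) K := GB.map (algebraMap B K)
    have hGdet : G.det * algebraMap B K t = 1 := by
      have : G.det = algebraMap B K GB.det := (RingHom.map_det _ _).symm
      rw [this, ← map_mul, hGBdet, map_one]
    have hG0 : G.det ≠ 0 := left_ne_zero_of_mul_eq_one hGdet
    have hGinv : G.det⁻¹ = algebraMap B K t := (eq_inv_of_mul_eq_one_right hGdet).symm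
    have hsome : ∀ d : Ex m n, φ (X (some d)) =
        coeff d.1 (sb G (map (algebraMap ℂ K) Q)) := by
      intro d
      rw [hAK]
      have : φ0 (X (some d)) = coeff d.1 (sb GB (map (algebraMap ℂ B) Q)) := by
        simp [φ0, pt]
      rw [this, ← coeff_map, sb_map, map_map, ← IsScalarTower.algebraMap_eq]
    have hnone : φ (X none) =
        algebraMap ℂ K a * (G.det⁻¹) ^ e := by
      rw [hAK, hGinv]
      have : φ0 (X none) = algebraMap ℂ B a * t ^ e := by
        simp [φ0, pt]
      rw [this, map_mul, map_pow, ← IsScalarTower.algebraMap_apply]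
    refine orbit_closed_aux hn Q hQ hx e he a ha K G hG0 hsome hnone x ?_
    intro f hf
    have h1 : algebraMap B K (φ0 f) = 0 := hf
    have h2 : φ0 f = 0 := by
      apply IsFractionRing.injective B K
      rw [h1, map_zero]
    exact hxJ f h2

lemma exists_haar_functional (U : Type*) [TopologicalSpace U] [Group U] [IsTopologicalGroup U]
    [CompactSpace U] :
    ∃ L : C(U, ℂ) →ₗ[ℂ] ℂ, (∀ c : ℂ, L (ContinuousMap.const U c) = c) ∧
      ∀ (f f' : C(U, ℂ)) (u0 : U), (∀ u, f' u = f (u0 * u)) → L f' = L f := by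
  let _ : MeasurableSpace U := borel U
  have : BorelSpace U := ⟨rfl⟩
  let μ : MeasureTheory.Measure U := MeasureTheory.Measure.haarMeasure ⊤
  have hμ : MeasureTheory.IsProbabilityMeasure μ := by
    constructor
    have := MeasureTheory.Measure.haarMeasure_self (K₀ := (⊤ : TopologicalSpace.PositiveCompacts U))
    simpa using this
  have hIntg : ∀ f : C(U, ℂ), MeasureTheory.Integrable f μ := fun f => by
    have := (map_continuous f).integrable_of_hasCompactSupport (μ := μ) (HasCompactSupport.of_compactSpace f)
    exact this
  refine ⟨{ toFun := fun f => ∫ u, f u ∂μ, map_add' := ?_, map_smul' := ?_ }, ?_, ?_⟩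
  · intro f g
    exact MeasureTheory.integral_add (hIntg f) (hIntg g)
  · intro c f
    exact MeasureTheory.integral_smul c _
  · intro c
    simp
  · intro f f' u0 h
    show ∫ u, f' u ∂μ = ∫ u, f u ∂μ
    simp_rw [h]
    exact MeasureTheory.integral_mul_left_eq_self (fun u => f u) u0

instance instCompactUnitary (m : ℕ) : CompactSpace (Matrix.unitaryGroup (Fin m) ℂ) := by
  refine (isCompact_iff_compactSpace (s := ((Matrix.unitaryGroup (Fin m) ℂ : Submonoid _) :
    Set (Matrix (Fin m) (Fin m) ℂ)))).1 ?_
  have h1 : IsCompact {M : Matrix (Fin m) (Fin m) ℂ | ∀ i j, M i j ∈ Metric.closedBall (0:ℂ) 1} := by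
    have : IsCompact (Set.pi Set.univ (fun _ : Fin m => Set.pi Set.univ
      (fun _ : Fin m => Metric.closedBall (0:ℂ) 1))) :=
      isCompact_univ_pi fun _ => isCompact_univ_pi fun _ => isCompact_closedBall _ _
    have hs : {M : Matrix (Fin m) (Fin m) ℂ | ∀ i j, M i j ∈ Metric.closedBall (0:ℂ) 1} =
        (Set.pi Set.univ (fun _ : Fin m => Set.pi Set.univ
          (fun _ : Fin m => Metric.closedBall (0:ℂ) 1)) : Set (Fin m → Fin m → ℂ)) := by
      apply Set.ext
      intro M
      exact ⟨fun h i _ j _ => h i j, fun h i j => h i trivial j trivial⟩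
    rw [hs]
    exact this
  refine h1.of_isClosed_subset ?_ ?_
  · have : ((Matrix.unitaryGroup (Fin m) ℂ : Submonoid _) : Set (Matrix (Fin m) (Fin m) ℂ)) =
      {M | M * star M = 1} := by
      ext M; exact Matrix.mem_unitaryGroup_iff
    rw [this]
    exact isClosed_eq (by fun_prop) continuous_const
  · intro M hM i j
    simpa using entry_norm_bound_of_unitary hM i j


open scoped ComplexOrder in
lemma kak {m : ℕ} (g : Matrix (Fin m) (Fin m) ℂ) (hg : IsUnit g.det) :
    ∃ u v : Matrix.unitaryGroup (Fin m) ℂ, ∃ d : Fin m → ℂ,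
      g = (u : Matrix _ _ ℂ) * Matrix.diagonal d * (v : Matrix _ _ ℂ) := by
  have hH : (g.conjTranspose * g).IsHermitian := Matrix.isHermitian_conjTranspose_mul_self g
  have hpd : (g.conjTranspose * g).PosDef :=
    Matrix.PosDef.conjTranspose_mul_self _ (Matrix.mulVec_injective_of_isUnit ((Matrix.isUnit_iff_isUnit_det _).2 hg))
  have hpos : ∀ i, 0 < hH.eigenvalues i := hpd.eigenvalues_pos
  have hsp := hH.conjStarAlgAut_star_eigenvectorUnitary
  rw [Unitary.conjStarAlgAut_apply] at hsp
  set v0 : Matrix (Fin m) (Fin m) ℂ := (hH.eigenvectorUnitary : Matrix (Fin m) (Fin m) ℂ) with hv0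
  have hv1 : v0 * star v0 = 1 := Matrix.mem_unitaryGroup_iff.1 hH.eigenvectorUnitary.2
  have hv2 : star v0 * v0 = 1 := Matrix.mem_unitaryGroup_iff'.1 hH.eigenvectorUnitary.2
  let d : Fin m → ℂ := fun i => ((Real.sqrt (hH.eigenvalues i) : ℝ) : ℂ)
  have hd0 : ∀ i, d i ≠ 0 := fun i => by
    simp only [d]
    exact_mod_cast (Real.sqrt_pos.2 (hpos i)).ne'
  have hdd : ∀ i, d i * d i = ((hH.eigenvalues i : ℝ) : ℂ) := fun i => by
    simp only [d]
    rw [← Complex.ofReal_mul, Real.mul_self_sqrt (hpos i).le]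
  let di : Fin m → ℂ := fun i => (d i)⁻¹
  have hdstar : star di = di := by
    funext i
    simp [di, d]
  have hsp' : star v0 * (star g * g) * v0 = Matrix.diagonal fun i => d i * d i := by
    have : (Matrix.diagonal fun i => d i * d i) =
        Matrix.diagonal (RCLike.ofReal ∘ hH.eigenvalues : Fin m → ℂ) := by
      congr 1; funext i; rw [hdd]; rfl
    rw [this, ← hsp]
    simp [Matrix.star_eq_conjTranspose, hv0]
  let u0 : Matrix (Fin m) (Fin m) ℂ := g * v0 * Matrix.diagonal di
  have hu0 : star u0 * u0 = 1 := by
    have h1 : star u0 * u0 = star (Matrix.diagonal di) * (star v0 * (star g * g) * v0) *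
        Matrix.diagonal di := by
      simp only [u0, star_mul, Matrix.mul_assoc]
    rw [h1, hsp', Matrix.star_eq_conjTranspose, Matrix.diagonal_conjTranspose, hdstar,
      Matrix.diagonal_mul_diagonal, Matrix.diagonal_mul_diagonal, ← Matrix.diagonal_one]
    congr 1
    funext i
    have := hd0 i
    simp only [di]
    field_simp
  refine ⟨⟨u0, Matrix.mem_unitaryGroup_iff'.2 hu0⟩, star hH.eigenvectorUnitary, d, ?_⟩
  show g = g * v0 * Matrix.diagonal di * Matrix.diagonal d * star v0
  rw [Matrix.mul_assoc (g * v0), Matrix.diagonal_mul_diagonal]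
  have : (Matrix.diagonal fun i => di i * d i) = (1 : Matrix (Fin m) (Fin m) ℂ) := by
    rw [← Matrix.diagonal_one]
    congr 1
    funext i
    exact inv_mul_cancel₀ (hd0 i)
  rw [this, Matrix.mul_one, Matrix.mul_assoc, hv1, Matrix.mul_one]

lemma eval_aeval_eq {σ : Type*} (p : MvPolynomial σ ℂ) {R : Type*} [CommRing R] [Algebra ℂ R]
    (f : R →+* ℂ) (hf : f.comp (algebraMap ℂ R) = RingHom.id ℂ) (y : σ → R) :
    f (aeval y p) = eval (fun i => f (y i)) p := by
  show (f.comp (eval₂Hom (algebraMap ℂ R) y)) p = _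
  rw [comp_eval₂Hom, hf]
  rfl

lemma unitary_dense {m : ℕ} (p : MvPolynomial (Fin m × Fin m) ℂ)
    (h : ∀ u : Matrix (Fin m) (Fin m) ℂ, u ∈ Matrix.unitaryGroup (Fin m) ℂ →
      eval (fun ij => u ij.1 ij.2) p = 0)
    (g : Matrix (Fin m) (Fin m) ℂ) (hg : IsUnit g.det) : eval (fun ij => g ij.1 ij.2) p = 0 := by
  obtain ⟨⟨u, hu⟩, ⟨v, hv⟩, d, rfl⟩ := kak g hg
  simp only
  let M : Matrix (Fin m) (Fin m) (MvPolynomial (Fin m) ℂ) :=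
    u.map C * Matrix.diagonal X * v.map C
  let q : MvPolynomial (Fin m) ℂ := aeval (fun ij : Fin m × Fin m => M ij.1 ij.2) p
  have hq : ∀ d : Fin m → ℂ, eval d q = eval (fun ij => (u * Matrix.diagonal d * v) ij.1 ij.2) p := by
    intro d
    have hM : M.map (eval d) = u * Matrix.diagonal d * v := by
      ext i j
      simp [M, Matrix.mul_apply, Matrix.diagonal_apply]
    rw [← hM]
    exact eval_aeval_eq p (eval d) (by ext; simp) _
  rw [← hq]
  have : q = 0 := by
    apply MvPolynomial.funext_set (fun _ => Metric.sphere (0:ℂ) 1)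
    · intro i
      apply IsPreconnected.infinite_of_nontrivial
      · exact isPreconnected_sphere (by rw [Complex.rank_real_complex]; norm_num) _ _
      · exact ⟨1, by simp, -1, by simp, by norm_num⟩
    · intro x hx
      rw [hq, map_zero]
      apply h
      refine mul_mem (mul_mem hu ?_) hv
      rw [Matrix.mem_unitaryGroup_iff, Matrix.star_eq_conjTranspose, Matrix.diagonal_conjTranspose,
        Matrix.diagonal_mul_diagonal, ← Matrix.diagonal_one]
      congr 1
      funext i
      have := hx i (Set.mem_univ i)
      simp only [mem_sphere_iff_norm, sub_zero] at this
      simp [Complex.mul_conj, Complex.normSq_eq_norm_sq, this]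
  rw [this, map_zero]

/-- Coefficient vector. -/
noncomputable def co {R : Type*} [CommRing R] {m : ℕ} (n : ℕ) (Q : MvPolynomial (Fin m) R) :
    Ex m n → R := fun d => coeff d.1 Q

/-- Split off the extra variable. -/
noncomputable def spl (τ : Type*) : MvPolynomial (Option τ) ℂ →ₐ[ℂ] Polynomial (MvPolynomial τ ℂ) :=
  aeval fun o => o.elim Polynomial.X (fun d => Polynomial.C (X d))

lemma eval_spl {m n : ℕ} (F : MvPolynomial (Option (Ex m n)) ℂ) (Q : MvPolynomial (Fin m) ℂ) (s : ℂ) :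
    eval (pt n Q s) F = Polynomial.eval s ((spl _ F).map (eval (co n Q))) := by
  have := eval_aeval_eq F ((Polynomial.evalRingHom s).comp (Polynomial.mapRingHom (eval (co n Q))))
    (by
      ext c
      simp [Polynomial.algebraMap_apply])
    (fun o => o.elim Polynomial.X (fun d => Polynomial.C (X d)))
  refine Eq.trans ?_ this.symm
  congr 2
  funext o
  cases o <;> simp [pt, co]

/-- apply a linear functional to coefficients -/
lemma exists_avg_poly {τ R : Type*} [CommRing R] [Algebra ℂ R] (L : R →ₗ[ℂ] ℂ)
    (p : MvPolynomial τ R) : ∃ F : MvPolynomial τ ℂ,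
      ∀ x : τ → ℂ, eval x F = L (eval (fun i => algebraMap ℂ R (x i)) p) := by
  refine ⟨∑ d ∈ p.support, monomial d (L (coeff d p)), fun x => ?_⟩
  rw [map_sum, eval_eq, map_sum]
  refine Finset.sum_congr rfl fun d _ => ?_
  rw [eval_monomial, Finsupp.prod]
  simp_rw [← map_pow]
  rw [← map_prod, mul_comm (coeff d p), ← Algebra.smul_def, map_smul, smul_eq_mul, mul_comm]

noncomputable instance instFintypeEx (m n : ℕ) : Fintype (Ex m n) := Fintype.ofFinite _

/-- form with given coefficients -/
noncomputable def gen {R : Type*} [CommRing R] (m n : ℕ) (y : Ex m n → R) : MvPolynomial (Fin m) R :=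
  ∑ d : Ex m n, monomial d.1 (y d)

lemma gen_map {R S : Type*} [CommRing R] [CommRing S] (m n : ℕ) (y : Ex m n → R) (f : R →+* S) :
    map f (gen m n y) = gen m n (fun d => f (y d)) := by
  simp [gen]

lemma gen_co {R : Type*} [CommRing R] {m n : ℕ} (Q : MvPolynomial (Fin m) R) (hQ : Q.IsHomogeneous n) :
    gen m n (co n Q) = Q := by
  classical
  ext d
  simp only [gen, co, coeff_sum, coeff_monomial]
  by_cases hd : d.degree = n
  · rw [Finset.sum_eq_single ⟨d, hd⟩]
    · simp
    · intro b _ hb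
      rw [if_neg]
      intro h; exact hb (Subtype.ext h)
    · simp
  · rw [hQ.coeff_eq_zero hd]
    apply Finset.sum_eq_zero
    intro b _
    rw [if_neg]
    intro h; exact hd (h ▸ b.2)

theorem avg (m n e : ℕ) (f : MvPolynomial (Option (Ex m n)) ℂ) :
    ∃ F : MvPolynomial (Option (Ex m n)) ℂ,
      (∀ (Q : MvPolynomial (Fin m) ℂ), Q.IsHomogeneous n →
        ∀ (s : ℂ) (u : Matrix (Fin m) (Fin m) ℂ), u ∈ Matrix.unitaryGroup (Fin m) ℂ →
          eval (pt n (sb u Q) (s * (u.det)⁻¹ ^ e)) F = eval (pt n Q s) F) ∧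
      (∀ (Q : MvPolynomial (Fin m) ℂ), Q.IsHomogeneous n → ∀ s c : ℂ,
        (∀ g : Matrix (Fin m) (Fin m) ℂ, IsUnit g.det →
          eval (pt n (sb g Q) (s * (g.det)⁻¹ ^ e)) f = c) → eval (pt n Q s) F = c) := by
  let U := Matrix.unitaryGroup (Fin m) ℂ
  obtain ⟨L, hL1, hL2⟩ := exists_haar_functional U
  let R := C(U, ℂ)
  let T : Matrix (Fin m) (Fin m) R := Matrix.of fun i j =>
    ⟨fun u => (u : Matrix (Fin m) (Fin m) ℂ) i j, continuous_subtype_val.matrix_elem i j⟩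
  let D : R := ⟨fun u => ((u⁻¹ : U) : Matrix (Fin m) (Fin m) ℂ).det, by fun_prop⟩
  let RR := MvPolynomial (Option (Ex m n)) R
  let p : RR := aeval (pt n (sb (T.map C) (gen m n fun d => (X (some d) : RR)))
    (X none * C (D ^ e))) f
  obtain ⟨F, hF⟩ := exists_avg_poly L p
  have hdet : ∀ u : U, ((u⁻¹ : U) : Matrix (Fin m) (Fin m) ℂ).det =
      ((u : Matrix (Fin m) (Fin m) ℂ).det)⁻¹ := by
    intro u
    apply eq_inv_of_mul_eq_one_left
    rw [← Matrix.det_mul, ← Submonoid.coe_mul, inv_mul_cancel]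
    simp
  have hp : ∀ (Q : MvPolynomial (Fin m) ℂ), Q.IsHomogeneous n → ∀ (s : ℂ) (u : U),
      (eval (fun i => algebraMap ℂ R (pt n Q s i)) p : R) u =
      eval (pt n (sb (u : Matrix (Fin m) (Fin m) ℂ) Q)
        (s * ((u : Matrix (Fin m) (Fin m) ℂ).det)⁻¹ ^ e)) f := by
    intro Q hQ s u
    let ev : R →+* ℂ := ContinuousMap.evalAlgHom ℂ ℂ u |>.toRingHom
    let h : RR →+* ℂ := ev.comp (eval (fun i => algebraMap ℂ R (pt n Q s i)))
    have hev : ∀ c : ℂ, ev (algebraMap ℂ R c) = c := fun c => rfl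
    have hC : ∀ r : R, h (C r) = ev r := fun r => congrArg ev (eval_C r)
    have hX : ∀ o, h (X o) = pt n Q s o := fun o =>
      (congrArg ev (eval_X o)).trans (hev _)
    have := eval_aeval_eq f h (by
      ext c
      rw [RingHom.comp_apply, IsScalarTower.algebraMap_apply ℂ R RR]
      exact (hC _).trans (hev c)) (pt n (sb (T.map C) (gen m n fun d => (X (some d) : RR)))
        (X none * C (D ^ e)))
    refine this.trans ?_
    congr 2
    funext o
    rw [← pt_map, sb_map, gen_map, map_mul, hX, hC]
    have h1 : (fun d => h (X (some d))) = co n Q := by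
      funext d; rw [hX]; rfl
    have h2 : (T.map C).map h = (u : Matrix (Fin m) (Fin m) ℂ) := by
      ext i j
      exact hC _
    have h3 : ev (D ^ e) = ((u : Matrix (Fin m) (Fin m) ℂ).det)⁻¹ ^ e := by
      rw [map_pow, ← hdet]; rfl
    rw [h1, h2, h3, gen_co Q hQ]
    rfl
  refine ⟨F, ?_, ?_⟩
  · intro Q hQ s u hu
    rw [hF, hF]
    apply hL2 _ _ ⟨u, hu⟩
    intro w
    rw [hp _ (sb_homog u hQ), hp _ hQ, sb_mul]
    congr 2
    simp only [Submonoid.coe_mul, Matrix.det_mul, mul_inv, mul_pow, mul_assoc]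
  · intro Q hQ s c hc
    rw [hF, ← hL1 c]
    congr 1
    ext w
    rw [hp _ hQ]
    rw [hc]
    · rfl
    · exact (Matrix.isUnit_iff_isUnit_det _).1 (by
        refine ⟨Unitary.toUnits w, rfl⟩)

/-- Coefficient polynomial covariant of weight `k`. -/
def Cov (m n k : ℕ) (P : MvPolynomial (Ex m n) ℂ) : Prop :=
  ∀ Q : MvPolynomial (Fin m) ℂ, Q.IsHomogeneous n → ∀ g : Matrix (Fin m) (Fin m) ℂ, IsUnit g.det →
    eval (co n (sb g Q)) P = g.det ^ k * eval (co n Q) P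

lemma Cov.pow {m n k : ℕ} {P : MvPolynomial (Ex m n) ℂ} (h : Cov m n k P) (r : ℕ) :
    Cov m n (k * r) (P ^ r) := by
  intro Q hQ g hg
  rw [map_pow, map_pow, h Q hQ g hg, mul_pow, pow_mul]

lemma Cov.add {m n k : ℕ} {P P' : MvPolynomial (Ex m n) ℂ} (h : Cov m n k P) (h' : Cov m n k P') :
    Cov m n k (P + P') := by
  intro Q hQ g hg
  rw [map_add, map_add, h Q hQ g hg, h' Q hQ g hg, mul_add]

lemma Cov.isRel {m n k : ℕ} {P : MvPolynomial (Ex m n) ℂ} (h : Cov m n k P) :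
    IsRelInvariant m n k (fun Q => eval (co n Q) P) := by
  refine ⟨⟨rename Subtype.val P, fun Q => ?_⟩, fun Q hQ C hC => ?_⟩
  · rw [eval_rename]; rfl
  · have h1 : substMatM m C⁻¹ Q = sb C⁻¹ Q := rfl
    have hC' : IsUnit (C⁻¹).det := by
      rw [Matrix.det_nonsing_inv]
      exact hC.ringInverse
    simp only
    rw [h1, h Q hQ _ hC', ← mul_assoc, ← mul_pow, ← Matrix.det_mul, Matrix.mul_nonsing_inv _ hC]
    simp

lemma cov_of_unitary {m n k : ℕ} (P : MvPolynomial (Ex m n) ℂ)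
    (h : ∀ Q : MvPolynomial (Fin m) ℂ, Q.IsHomogeneous n → ∀ g : Matrix (Fin m) (Fin m) ℂ,
      g ∈ Matrix.unitaryGroup (Fin m) ℂ → eval (co n (sb g Q)) P = g.det ^ k * eval (co n Q) P) :
    Cov m n k P := by
  intro Q hQ g hg
  let G0 : Matrix (Fin m) (Fin m) (MvPolynomial (Fin m × Fin m) ℂ) := Matrix.of fun i j => X (i, j)
  let p : MvPolynomial (Fin m × Fin m) ℂ :=
    aeval (co n (sb G0 (map C Q))) P - G0.det ^ k * C (eval (co n Q) P)
  have hp : ∀ g : Matrix (Fin m) (Fin m) ℂ, eval (fun ij => g ij.1 ij.2) p =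
      eval (co n (sb g Q)) P - g.det ^ k * eval (co n Q) P := by
    intro g
    have hG : G0.map (eval fun ij => g ij.1 ij.2) = g := by
      ext i j; simp [G0]
    have hdet : eval (fun ij => g ij.1 ij.2) G0.det = g.det := by
      rw [RingHom.map_det]; exact congrArg _ hG
    have h1 := eval_aeval_eq P (eval fun ij : Fin m × Fin m => g ij.1 ij.2) (by ext c; simp)
      (co n (sb G0 (map C Q)))
    have h2 : (fun d => eval (fun ij : Fin m × Fin m => g ij.1 ij.2) (co n (sb G0 (map C Q)) d)) =
        co n (sb g Q) := by
      funext d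
      simp only [co]
      rw [← coeff_map, sb_map, hG, map_map]
      congr 2
      have : (eval fun ij : Fin m × Fin m => g ij.1 ij.2).comp C = RingHom.id ℂ := by
        ext c; simp
      rw [this, map_id]
    simp only [p]
    rw [map_sub, h1, h2, map_mul, map_pow, hdet, eval_C]
  have := unitary_dense p (fun u hu => by rw [hp, h Q hQ u hu, sub_self]) g hg
  rw [hp] at this
  exact sub_eq_zero.1 this

theorem avg_inv (m n e : ℕ) (f : MvPolynomial (Option (Ex m n)) ℂ) :
    ∃ A : Polynomial (MvPolynomial (Ex m n) ℂ), (∀ k, Cov m n (e * k) (A.coeff k)) ∧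
      (∀ (Q : MvPolynomial (Fin m) ℂ), Q.IsHomogeneous n → ∀ s c : ℂ,
        (∀ g : Matrix (Fin m) (Fin m) ℂ, IsUnit g.det →
          eval (pt n (sb g Q) (s * (g.det)⁻¹ ^ e)) f = c) →
        (A.map (eval (co n Q))).eval s = c) := by
  obtain ⟨F, hF1, hF2⟩ := avg m n e f
  refine ⟨spl _ F, ?_, ?_⟩
  · intro k
    apply cov_of_unitary
    intro Q hQ u hu
    have hu0 : u.det ≠ 0 := by
      have h1 := congrArg Matrix.det (Matrix.mem_unitaryGroup_iff.1 hu)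
      rw [Matrix.det_mul, Matrix.det_one] at h1
      exact left_ne_zero_of_mul_eq_one h1
    have h1 : ((spl _ F).map (eval (co n (sb u Q)))).comp
        (Polynomial.C ((u.det)⁻¹ ^ e) * Polynomial.X) = (spl _ F).map (eval (co n Q)) := by
      apply Polynomial.funext
      intro s
      have h2 := hF1 Q hQ s u hu
      rw [eval_spl, eval_spl] at h2
      rw [← h2, Polynomial.eval_comp]
      rw [Polynomial.eval_mul, Polynomial.eval_C, Polynomial.eval_X, mul_comm]
    have h3 := congrArg (fun p => Polynomial.coeff p k) h1
    simp only [Polynomial.comp_C_mul_X_coeff, Polynomial.coeff_map] at h3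
    rw [← h3, pow_mul, mul_comm _ ((u.det⁻¹ ^ e) ^ k), ← mul_assoc, ← mul_pow, ← mul_pow,
      mul_inv_cancel₀ hu0]
    simp
  · intro Q hQ s c hc
    rw [← eval_spl]
    exact hF2 Q hQ s c hc

lemma exists_nonvanishing {m n : ℕ} (hn : 3 ≤ n) (Q : MvPolynomial (Fin m) ℂ)
    (hQ : Q.IsHomogeneous n)
    (hx : ∀ z : Fin m → ℂ, (∀ i, eval z (pderiv i Q) = 0) → z = 0) :
    ∃ k, 1 ≤ k ∧ ∃ P, Cov m n k P ∧ eval (co n Q) P ≠ 0 := by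
  obtain ⟨J, hJ1, hJ2⟩ := orbit_ideal hn Q hQ hx 1 le_rfl 1 one_ne_zero
  obtain ⟨f, hf, hf'⟩ := exists_sep J (Ideal.span {X none}) (by
    intro x h1 h2
    obtain ⟨g, hg, rfl⟩ := hJ2 x h1
    have := h2 (X none) (Ideal.subset_span rfl)
    rw [eval_X] at this
    simp only [pt, Option.elim_none, one_mul, pow_one, inv_eq_zero] at this
    exact hg.ne_zero this)
  obtain ⟨A, hA1, hA2⟩ := avg_inv m n 1 (1 - f)
  have e1 := hA2 Q hQ 1 1 (fun g hg => by rw [map_sub, hJ1 f hf g hg]; simp)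
  have e0 := hA2 Q hQ 0 0 (fun g hg => by
    obtain ⟨h, hh⟩ := Ideal.mem_span_singleton.1 hf'
    rw [hh, map_mul, eval_X]
    simp [pt])
  by_contra hcon
  push Not at hcon
  have h3 : A.map (eval (co n Q)) = Polynomial.C ((A.map (eval (co n Q))).coeff 0) := by
    ext k
    rw [Polynomial.coeff_C]
    split_ifs with hk
    · rw [hk]
    · rw [Polynomial.coeff_map]
      exact hcon (1 * k) (by omega) _ (hA1 k)
  rw [h3, Polynomial.eval_C] at e1 e0
  rw [e0] at e1
  exact zero_ne_one e1

/-- For `m ≥ 2`, `n ≥ 3`, two forms in `X_m^n` (degree-`n` forms whose partial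
derivatives have no common zero except the origin) that are not linearly equivalent are
separated by a ratio of relative classical invariants of equal weight: there are relative
invariants `I, I'` of the same weight with `I'(Q1) ≠ 0`, `I'(Q2) ≠ 0` and
`I(Q1) I'(Q2) ≠ I(Q2) I'(Q1)`. -/
theorem orbits_separated_by_absolute_invariants (m n : ℕ) (hm : 2 ≤ m) (hn : 3 ≤ n)
    (Q1 Q2 : MvPolynomial (Fin m) ℂ)
    (h1 : Q1.IsHomogeneous n) (h2 : Q2.IsHomogeneous n)
    (hx1 : ∀ z : Fin m → ℂ, (∀ i, eval z (pderiv i Q1) = 0) → z = 0)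
    (hx2 : ∀ z : Fin m → ℂ, (∀ i, eval z (pderiv i Q2) = 0) → z = 0)
    (hne : ¬ ∃ C : Matrix (Fin m) (Fin m) ℂ, IsUnit C.det ∧ substMatM m C Q1 = Q2) :
    ∃ (k : ℕ) (I I' : MvPolynomial (Fin m) ℂ → ℂ),
      IsRelInvariant m n k I ∧ IsRelInvariant m n k I' ∧
      I' Q1 ≠ 0 ∧ I' Q2 ≠ 0 ∧ I Q1 * I' Q2 ≠ I Q2 * I' Q1 := by
  obtain ⟨k1, hk1, P1, hP1, hv1⟩ := exists_nonvanishing hn Q1 h1 hx1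
  obtain ⟨k2, hk2, P2, hP2, hv2⟩ := exists_nonvanishing hn Q2 h2 hx2
  obtain ⟨e, he, P, hP, hPQ1, hPQ2⟩ : ∃ e, 1 ≤ e ∧ ∃ P, Cov m n e P ∧ eval (co n Q1) P ≠ 0 ∧
      eval (co n Q2) P ≠ 0 := by
    have hA := hP1.pow k2
    have hB := hP2.pow k1
    rw [mul_comm k2 k1] at hB
    have hpos : 1 ≤ k1 * k2 := Nat.mul_pos hk1 hk2
    have hA1 : eval (co n Q1) (P1 ^ k2) ≠ 0 := by rw [map_pow]; exact pow_ne_zero _ hv1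
    have hB2 : eval (co n Q2) (P2 ^ k1) ≠ 0 := by rw [map_pow]; exact pow_ne_zero _ hv2
    by_cases hA2 : eval (co n Q2) (P1 ^ k2) = 0
    · by_cases hB1 : eval (co n Q1) (P2 ^ k1) = 0
      · refine ⟨_, hpos, _, hA.add hB, ?_, ?_⟩
        · rwa [map_add, hB1, add_zero]
        · rwa [map_add, hA2, zero_add]
      · exact ⟨_, hpos, _, hB, hB1, hB2⟩
    · exact ⟨_, hpos, _, hA, hA1, hA2⟩
  set b1 := eval (co n Q1) P with hb1
  set b2 := eval (co n Q2) P with hb2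
  obtain ⟨J1, hJ1, hJ1'⟩ := orbit_ideal hn Q1 h1 hx1 e he b1⁻¹ (inv_ne_zero hPQ1)
  obtain ⟨J2, hJ2, hJ2'⟩ := orbit_ideal hn Q2 h2 hx2 e he b2⁻¹ (inv_ne_zero hPQ2)
  obtain ⟨f, hf, hf'⟩ := exists_sep J1 J2 (by
    intro x hx1 hx2
    obtain ⟨g1, hg1, rfl⟩ := hJ1' x hx1
    obtain ⟨g2, hg2, hgg⟩ := hJ2' _ hx2
    apply hne
    refine ⟨g1 * g2⁻¹, ?_, ?_⟩
    · rw [Matrix.det_mul, Matrix.det_nonsing_inv]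
      exact hg1.mul hg2.ringInverse
    · have hco : co n (sb g1 Q1) = co n (sb g2 Q2) := by
        funext d
        exact congrFun hgg (some d)
      have hsb : sb g1 Q1 = sb g2 Q2 := by
        rw [← gen_co _ (sb_homog g1 h1), hco, gen_co _ (sb_homog g2 h2)]
      show sb (g1 * g2⁻¹) Q1 = Q2
      rw [← sb_mul, hsb, sb_mul, Matrix.mul_nonsing_inv _ hg2, sb_one])
  obtain ⟨A, hA1, hA2⟩ := avg_inv m n e f
  have e1 := hA2 Q1 h1 b1⁻¹ 0 (fun g hg => hJ1 f hf g hg)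
  have e2 := hA2 Q2 h2 b2⁻¹ 1 (fun g hg => by
    have := hJ2 _ hf' g hg
    rw [map_sub, map_one, sub_eq_zero] at this
    exact this.symm)
  by_contra hcon
  push Not at hcon
  have key : ∀ k, eval (co n Q1) (A.coeff k) * b2 ^ k = eval (co n Q2) (A.coeff k) * b1 ^ k := by
    intro k
    have h3 := hcon (e * k) _ _ (hA1 k).isRel (hP.pow k).isRel
    simp only [map_pow] at h3
    exact h3 (pow_ne_zero _ hPQ1) (pow_ne_zero _ hPQ2)
  have h4 : (A.map (eval (co n Q1))).comp (Polynomial.C b1⁻¹ * Polynomial.X) =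
      (A.map (eval (co n Q2))).comp (Polynomial.C b2⁻¹ * Polynomial.X) := by
    ext k
    simp only [Polynomial.comp_C_mul_X_coeff, Polynomial.coeff_map]
    have := key k
    have p1 := pow_ne_zero k hPQ1
    have p2 := pow_ne_zero k hPQ2
    rw [inv_pow, inv_pow, ← div_eq_mul_inv, ← div_eq_mul_inv, div_eq_div_iff p1 p2]
    exact this
  have h5 := congrArg (Polynomial.eval 1) h4
  simp only [Polynomial.eval_comp, Polynomial.eval_mul, Polynomial.eval_C, Polynomial.eval_X,
    mul_one] at h5
  rw [e1, e2] at h5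
  exact zero_ne_one h5
end

section
/- A binary sextic Q is linearly equivalent to a sextic in Sylvester Canonical Form if and only if the endomorphism Q̂ has a square-free eigencubic, i.e., there exist λ ∈ ℂ and a square-free binary cubic Q' with Q̂(Q') = λ·Q'. -/
open MvPolynomial Finset

/-- The binary sextic `Σ_{i=0}^{6} binom(6,i) a_i z1^i z2^{6−i}`. -/
noncomputable def sexticOf (a : ℕ → ℂ) : MvPolynomial (Fin 2) ℂ :=
  ∑ i ∈ Finset.range 7,
    MvPolynomial.C ((Nat.choose 6 i : ℂ) * a i) * X 0 ^ i * X 1 ^ (6 - i)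

/-- The binary cubic `b0 z1^3 + b1 z1^2 z2 + b2 z1 z2^2 + b3 z2^3`. -/
noncomputable def cubicOf (b : Fin 4 → ℂ) : MvPolynomial (Fin 2) ℂ :=
  MvPolynomial.C (b 0) * X 0 ^ 3 + MvPolynomial.C (b 1) * X 0 ^ 2 * X 1
    + MvPolynomial.C (b 2) * X 0 * X 1 ^ 2 + MvPolynomial.C (b 3) * X 1 ^ 3

/-- The value of the endomorphism `Q̂` (for the sextic with coefficients `a`) on the binary
cubic with coefficients `b`, determined by `Q̂(z1^3) = −a3 z1^3 − 3a2 z1^2z2 − 3a1 z1z2^2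
− a0 z2^3`, `Q̂(z1^2z2) = a4 z1^3 + 3a3 z1^2z2 + 3a2 z1z2^2 + a1 z2^3`, `Q̂(z1z2^2) = −a5 z1^3
− 3a4 z1^2z2 − 3a3 z1z2^2 − a2 z2^3`, `Q̂(z2^3) = a6 z1^3 + 3a5 z1^2z2 + 3a4 z1z2^2 + a3 z2^3`
and linearity. -/
noncomputable def qhatApply (a : ℕ → ℂ) (b : Fin 4 → ℂ) : MvPolynomial (Fin 2) ℂ :=
  cubicOf ![-(a 3) * b 0 + a 4 * b 1 - a 5 * b 2 + a 6 * b 3,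
            -3 * a 2 * b 0 + 3 * a 3 * b 1 - 3 * a 4 * b 2 + 3 * a 5 * b 3,
            -3 * a 1 * b 0 + 3 * a 2 * b 1 - 3 * a 3 * b 2 + 3 * a 4 * b 3,
            -(a 0) * b 0 + a 1 * b 1 - a 2 * b 2 + a 3 * b 3]

/-- Coefficients of the transformed sextic. -/
def sub6 (p q r s : ℂ) (a : ℕ → ℂ) : ℕ → ℂ := fun i =>
  ∑ j ∈ Finset.range (i + 1), ∑ k ∈ Finset.range (6 - i + 1),
    (Nat.choose i j : ℂ) * (Nat.choose (6 - i) k : ℂ) * p ^ j * r ^ (i - j) * q ^ k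
      * s ^ (6 - i - k) * a (j + k)

/-- Coefficients of the transformed cubic. -/
def sub3 (p q r s : ℂ) (b : Fin 4 → ℂ) : Fin 4 → ℂ :=
  ![b 0 * p ^ 3 + b 1 * p ^ 2 * r + b 2 * p * r ^ 2 + b 3 * r ^ 3,
    b 0 * (3 * p ^ 2 * q) + b 1 * (p ^ 2 * s + 2 * p * q * r) + b 2 * (2 * p * r * s + q * r ^ 2)
      + b 3 * (3 * r ^ 2 * s),
    b 0 * (3 * p * q ^ 2) + b 1 * (2 * p * q * s + q ^ 2 * r) + b 2 * (p * s ^ 2 + 2 * q * r * s)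
      + b 3 * (3 * r * s ^ 2),
    b 0 * q ^ 3 + b 1 * q ^ 2 * s + b 2 * q * s ^ 2 + b 3 * s ^ 3]

theorem subst_cubic (M : Matrix (Fin 2) (Fin 2) ℂ) (b : Fin 4 → ℂ) :
    substMat M (cubicOf b) = cubicOf (sub3 (M 0 0) (M 0 1) (M 1 0) (M 1 1) b) := by
  simp only [substMat, cubicOf, sub3, map_add, map_mul, map_pow, aeval_X, algHom_C,
    MvPolynomial.algebraMap_eq, Matrix.cons_val, map_ofNat]
  ring

theorem subst_sextic (M : Matrix (Fin 2) (Fin 2) ℂ) (a : ℕ → ℂ) :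
    substMat M (sexticOf a) = sexticOf (sub6 (M 0 0) (M 0 1) (M 1 0) (M 1 1) a) := by
  simp [substMat, sexticOf, sub6, Finset.sum_range_succ, Nat.choose, map_ofNat]
  ring

theorem equivar (p q r s lam : ℂ) (a : ℕ → ℂ) (b : Fin 4 → ℂ)
    (h : qhatApply a b = MvPolynomial.C lam * cubicOf b) :
    qhatApply (sub6 p q r s a) (sub3 p q r s b) =
      MvPolynomial.C ((p * s - q * r) ^ 3 * lam) * cubicOf (sub3 p q r s b) := by
  have key : qhatApply (sub6 p q r s a) (sub3 p q r s b) =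
      MvPolynomial.C ((p * s - q * r) ^ 3) * substMat !![p, q; r, s] (qhatApply a b) := by
    have hC : ∀ (c : ℂ) b, MvPolynomial.C c * cubicOf b = cubicOf (fun i => c * b i) := by
      intro c b
      simp only [cubicOf, map_mul]
      ring
    unfold qhatApply
    rw [subst_cubic, hC]
    congr 1
    funext i
    fin_cases i <;>
    · simp [sub3, sub6, Finset.sum_range_succ, Nat.choose, map_ofNat]
      ring
  rw [key, h]
  have := subst_cubic !![p, q; r, s] b
  simp only [Matrix.of_apply, Matrix.cons_val] at this
  rw [← this]
  simp only [substMat, map_mul, algHom_C, MvPolynomial.algebraMap_eq]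
  ring

theorem mono_form (c : ℂ) (i j : ℕ) :
    (MvPolynomial.C c * X 0 ^ i * X 1 ^ j : MvPolynomial (Fin 2) ℂ) =
      monomial (Finsupp.single 0 i + Finsupp.single 1 j) c := by
  rw [X_pow_eq_monomial, X_pow_eq_monomial, C_mul_monomial, monomial_mul]
  simp

theorem single_pair_inj {i j k l : ℕ}
    (h : (Finsupp.single 0 i + Finsupp.single 1 j : Fin 2 →₀ ℕ)
      = Finsupp.single 0 k + Finsupp.single 1 l) : i = k ∧ j = l := by
  have h0 := DFunLike.congr_fun h 0
  have h1 := DFunLike.congr_fun h 1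
  simp at h0 h1
  exact ⟨h0, h1⟩

theorem coeff_sextic (a : ℕ → ℂ) (i : ℕ) (hi : i < 7) :
    coeff (Finsupp.single 0 i + Finsupp.single 1 (6 - i)) (sexticOf a)
      = (Nat.choose 6 i : ℂ) * a i := by
  simp only [sexticOf, mono_form, coeff_sum, coeff_monomial]
  rw [Finset.sum_eq_single i]
  · simp
  · intro j _ hj
    rw [if_neg]
    intro h
    exact hj (single_pair_inj h).1
  · intro h
    exact absurd (Finset.mem_range.mpr hi) h

theorem sextic_inj {a a' : ℕ → ℂ} (h : sexticOf a = sexticOf a') (i : ℕ) (hi : i < 7) :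
    a i = a' i := by
  have h1 := coeff_sextic a i hi
  rw [h, coeff_sextic a' i hi] at h1
  have : (Nat.choose 6 i : ℂ) ≠ 0 := by
    exact_mod_cast (Nat.choose_pos (by omega)).ne'
  exact (mul_left_cancel₀ this h1).symm

theorem cubic_form (b : Fin 4 → ℂ) : cubicOf b =
    monomial (Finsupp.single 0 3 + Finsupp.single 1 0) (b 0)
    + monomial (Finsupp.single 0 2 + Finsupp.single 1 1) (b 1)
    + monomial (Finsupp.single 0 1 + Finsupp.single 1 2) (b 2)
    + monomial (Finsupp.single 0 0 + Finsupp.single 1 3) (b 3) := by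
  simp only [← mono_form, cubicOf]
  ring

theorem cubic_inj {b b' : Fin 4 → ℂ} (h : cubicOf b = cubicOf b') : b = b' := by
  have key : ∀ i j k l : ℕ, i ≠ k → (Finsupp.single 0 i + Finsupp.single 1 j : Fin 2 →₀ ℕ)
      ≠ Finsupp.single 0 k + Finsupp.single 1 l := fun i j k l hn he => hn (single_pair_inj he).1
  rw [cubic_form, cubic_form] at h
  funext i
  have hc := congrArg
    (coeff (Finsupp.single 0 (3 - (i : ℕ)) + Finsupp.single 1 (i : ℕ) : Fin 2 →₀ ℕ)) h
  simp only [coeff_add, coeff_monomial] at hc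
  fin_cases i
  · simpa [key, -Finsupp.single_zero] using hc
  · simpa [key, -Finsupp.single_zero] using hc
  · simpa [key, -Finsupp.single_zero] using hc
  · simpa [key, -Finsupp.single_zero] using hc

theorem C_mul_cubic (c : ℂ) (b : Fin 4 → ℂ) :
    MvPolynomial.C c * cubicOf b = cubicOf (fun i => c * b i) := by
  simp only [cubicOf, map_mul]
  ring

theorem quad_split (a b c : ℂ) : ∃ p q r s : ℂ, a = p * r ∧ b = p * s + q * r ∧ c = q * s := by
  by_cases ha : a = 0
  · exact ⟨0, 1, b, c, by simp [ha], by simp, by simp⟩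
  · obtain ⟨t, ht⟩ := IsAlgClosed.exists_root
      (Polynomial.C a * Polynomial.X ^ 2 + Polynomial.C b * Polynomial.X + Polynomial.C c)
      (by rw [Polynomial.degree_quadratic ha]; decide)
    simp at ht
    exact ⟨1, -t, a, b + a * t, by ring, by ring, by linear_combination ht⟩

theorem cubic_split (b0 b1 b2 b3 : ℂ) : ∃ p1 q1 p2 q2 p3 q3 : ℂ,
    b0 = p1 * p2 * p3 ∧ b1 = p1 * p2 * q3 + p1 * q2 * p3 + q1 * p2 * p3 ∧
    b2 = p1 * q2 * q3 + q1 * p2 * q3 + q1 * q2 * p3 ∧ b3 = q1 * q2 * q3 := by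
  by_cases h0 : b0 = 0
  · obtain ⟨p, q, r, s, h1, h2, h3⟩ := quad_split b1 b2 b3
    exact ⟨0, 1, p, q, r, s, by simp [h0], by rw [h1]; ring, by rw [h2]; ring, by rw [h3]; ring⟩
  · obtain ⟨t, ht⟩ := IsAlgClosed.exists_root
      (Polynomial.C b0 * Polynomial.X ^ 3 + Polynomial.C b1 * Polynomial.X ^ 2
        + Polynomial.C b2 * Polynomial.X + Polynomial.C b3)
      (by rw [Polynomial.degree_cubic h0]; decide)
    simp at ht
    obtain ⟨p, q, r, s, h1, h2, h3⟩ := quad_split b0 (b1 + b0 * t) (b2 + t * (b1 + b0 * t))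
    exact ⟨1, -t, p, q, r, s, by rw [h1]; ring,
      by linear_combination h2 - t * h1, by linear_combination h3 - t * h2,
      by linear_combination ht - t * h3⟩

/-- The linear form with given coefficients. -/
noncomputable def linForm (p q : ℂ) : MvPolynomial (Fin 2) ℂ :=
  MvPolynomial.C p * X 0 + MvPolynomial.C q * X 1

theorem linForm_not_unit (p q : ℂ) : ¬ IsUnit (linForm p q) := by
  intro h
  have := h.map (eval (fun _ : Fin 2 => (0 : ℂ)))
  simp [linForm] at this

theorem det_ne (p q r s : ℂ) (R : MvPolynomial (Fin 2) ℂ)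
    (h : Squarefree (linForm p q * linForm r s * R)) : p * s - q * r ≠ 0 := by
  intro hd
  have hne := h.ne_zero
  by_cases hp : p = 0
  · by_cases hq : q = 0
    · apply hne
      simp [linForm, hp, hq]
    · apply linForm_not_unit p q
      apply h
      refine ⟨MvPolynomial.C (s / q) * R, ?_⟩
      have hr : r = (s / q) * p := by
        field_simp
        linear_combination -hd
      have hs : s = (s / q) * q := by field_simp
      have : linForm r s = MvPolynomial.C (s / q) * linForm p q := by
        simp only [linForm]
        conv_lhs => rw [hr, hs]
        simp only [map_mul]
        rw [← hs]
        ring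
      rw [this]; ring
  · apply linForm_not_unit p q
    apply h
    refine ⟨MvPolynomial.C (r / p) * R, ?_⟩
    have hr : r = (r / p) * p := by field_simp
    have hs : s = (r / p) * q := by
      field_simp
      linear_combination hd
    have : linForm r s = MvPolynomial.C (r / p) * linForm p q := by
      simp only [linForm]
      conv_lhs => rw [hs, hr]
      simp only [map_mul]
      rw [← hr]
      ring
    rw [this]; ring

theorem sqfree_normal (b : Fin 4 → ℂ) (h : Squarefree (cubicOf b)) :
    ∃ p q r s : ℂ, p * s - q * r ≠ 0 ∧ b = sub3 p q r s ![0, 1, 1, 0] := by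
  obtain ⟨p1, q1, p2, q2, p3, q3, h0, h1, h2, h3⟩ := cubic_split (b 0) (b 1) (b 2) (b 3)
  have hb : cubicOf b = linForm p1 q1 * linForm p2 q2 * linForm p3 q3 := by
    simp only [cubicOf, linForm, h0, h1, h2, h3, map_add, map_mul]
    ring
  rw [hb] at h
  have d12 := det_ne _ _ _ _ _ h
  have d13 := det_ne p1 q1 p3 q3 (linForm p2 q2) (by convert h using 1; ring)
  have d23 := det_ne p2 q2 p3 q3 (linForm p1 q1) (by convert h using 1; ring)
  -- l3 = al * l1 + be * l2
  set D := p1 * q2 - q1 * p2 with hD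
  set al := (p3 * q2 - q3 * p2) / D with hal
  set be := (p1 * q3 - q1 * p3) / D with hbe
  have hal0 : al ≠ 0 := div_ne_zero (fun hh => d23 (by linear_combination -hh)) d12
  have hbe0 : be ≠ 0 := div_ne_zero d13 d12
  have e1 : p3 = al * p1 + be * p2 := by
    rw [hal, hbe]; field_simp; rw [hD]; ring
  have e2 : q3 = al * q1 + be * q2 := by
    rw [hal, hbe]; field_simp; rw [hD]; ring
  obtain ⟨g, hg⟩ := IsAlgClosed.exists_pow_nat_eq (1 / (al * be)) (n := 3) (by norm_num)
  have hg' : g ^ 3 * (al * be) = 1 := by rw [hg]; field_simp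
  have hg0 : g ≠ 0 := by rintro rfl; norm_num at hg'
  refine ⟨g * al * p1, g * al * q1, g * be * p2, g * be * q2, ?_, ?_⟩
  · have : g * al * p1 * (g * be * q2) - g * al * q1 * (g * be * p2) = g * al * (g * be) * D := by
      rw [hD]; ring
    rw [this]
    exact mul_ne_zero (mul_ne_zero (mul_ne_zero hg0 hal0) (mul_ne_zero hg0 hbe0)) d12
  · clear_value al be
    funext i
    fin_cases i
    · simp [sub3]
      rw [h0, e1]
      linear_combination (-p1 * p2 * (al * p1 + be * p2)) * hg'
    · simp [sub3]
      rw [h1, e1, e2]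
      linear_combination (-(p1 * p2 * (al * q1 + be * q2) + p1 * q2 * (al * p1 + be * p2)
        + q1 * p2 * (al * p1 + be * p2))) * hg'
    · simp [sub3]
      rw [h2, e1, e2]
      linear_combination (-(p1 * q2 * (al * q1 + be * q2) + q1 * p2 * (al * q1 + be * q2)
        + q1 * q2 * (al * p1 + be * p2))) * hg'
    · simp [sub3]
      rw [h3, e2]
      linear_combination (-q1 * q2 * (al * q1 + be * q2)) * hg'

theorem substMat_comp (M N : Matrix (Fin 2) (Fin 2) ℂ) (Q : MvPolynomial (Fin 2) ℂ) :
    substMat N (substMat M Q) = substMat (M * N) Q := by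
  unfold substMat
  rw [← AlgHom.comp_apply]
  refine DFunLike.congr_fun ?_ Q
  apply MvPolynomial.algHom_ext
  intro i
  simp [Matrix.mul_apply, Fin.sum_univ_two]
  ring

theorem substMat_one (Q : MvPolynomial (Fin 2) ℂ) : substMat 1 Q = Q := by
  have h : (fun i : Fin 2 => (MvPolynomial.C ((1 : Matrix (Fin 2) (Fin 2) ℂ) i 0) * X 0
      + MvPolynomial.C ((1 : Matrix (Fin 2) (Fin 2) ℂ) i 1) * X 1 : MvPolynomial (Fin 2) ℂ))
      = X := by
    funext i
    revert i
    rw [Fin.forall_fin_two]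
    simp
  rw [substMat, h, aeval_X_left_apply]

theorem substMat_mul (M : Matrix (Fin 2) (Fin 2) ℂ) (P Q : MvPolynomial (Fin 2) ℂ) :
    substMat M (P * Q) = substMat M P * substMat M Q := by
  simp [substMat]

theorem sqfree_subst (M : Matrix (Fin 2) (Fin 2) ℂ) (hM : IsUnit M.det)
    (P : MvPolynomial (Fin 2) ℂ) (h : Squarefree P) : Squarefree (substMat M P) := by
  intro d hd
  obtain ⟨e, he⟩ := hd
  have h1 : P = substMat M⁻¹ d * substMat M⁻¹ d * substMat M⁻¹ e := by
    rw [← substMat_mul, ← substMat_mul, ← he, substMat_comp, Matrix.mul_nonsing_inv _ hM,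
      substMat_one]
  have h2 : IsUnit (substMat M⁻¹ d) := h _ ⟨_, h1⟩
  have h3 : IsUnit (substMat M (substMat M⁻¹ d)) := by
    unfold substMat at h2 ⊢
    exact h2.map _
  rwa [substMat_comp, Matrix.nonsing_inv_mul _ hM, substMat_one] at h3

theorem prime_sum : Prime (X 0 + X 1 : MvPolynomial (Fin 2) ℂ) := by
  let f : MvPolynomial (Fin 2) ℂ →ₐ[ℂ] MvPolynomial (Fin 2) ℂ := aeval ![X 0 + X 1, X 1]
  let g : MvPolynomial (Fin 2) ℂ →ₐ[ℂ] MvPolynomial (Fin 2) ℂ := aeval ![X 0 - X 1, X 1]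
  have f0 : f (X 0) = X 0 + X 1 := by simp [f]
  have f1 : f (X 1) = X 1 := by simp [f]
  have g0 : g (X 0) = X 0 - X 1 := by simp [g]
  have g1 : g (X 1) = X 1 := by simp [g]
  clear_value f g
  have hfg : f.comp g = AlgHom.id ℂ _ := by
    apply MvPolynomial.algHom_ext
    rw [Fin.forall_fin_two]
    simp [f0, f1, g0, g1]
  have hgf : g.comp f = AlgHom.id ℂ _ := by
    apply MvPolynomial.algHom_ext
    rw [Fin.forall_fin_two]
    simp [f0, f1, g0, g1]
  have := (MulEquiv.prime_iff (AlgEquiv.ofAlgHom f g hfg hgf)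
    (p := (X 0 : MvPolynomial (Fin 2) ℂ))).mpr X_prime
  rwa [AlgEquiv.ofAlgHom_apply, f0] at this

theorem sqfree_base : Squarefree (cubicOf ![0, 1, 1, 0]) := by
  have h : cubicOf ![0, 1, 1, 0] = X 0 * (X 1 * (X 0 + X 1)) := by
    simp [cubicOf]; ring
  have nd : ∀ (P Q : MvPolynomial (Fin 2) ℂ) (v : Fin 2 → ℂ), eval v P = 0 → eval v Q ≠ 0 →
      ¬ P ∣ Q := by
    rintro P Q v h1 h2 ⟨R, rfl⟩
    simp [h1] at h2
  have p0 : Prime (X 0 : MvPolynomial (Fin 2) ℂ) := X_prime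
  have p1 : Prime (X 1 : MvPolynomial (Fin 2) ℂ) := X_prime
  rw [h, squarefree_mul_iff, squarefree_mul_iff]
  refine ⟨?_, p0.irreducible.squarefree, ?_, p1.irreducible.squarefree,
    prime_sum.irreducible.squarefree⟩
  · rw [p0.irreducible.isRelPrime_iff_not_dvd]
    exact nd _ _ ![0, 1] (by simp) (by simp)
  · rw [p1.irreducible.isRelPrime_iff_not_dvd]
    exact nd _ _ ![1, 0] (by simp) (by simp)

theorem homog_one (u : MvPolynomial (Fin 2) ℂ) (h : u.IsHomogeneous 1) :
    ∃ p q : ℂ, u = linForm p q := by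
  have h1 : u ∈ homogeneousSubmodule (Fin 2) ℂ 1 := h
  rw [homogeneousSubmodule_one_eq_span_X, Submodule.mem_span_range_iff_exists_fun] at h1
  obtain ⟨c, hc⟩ := h1
  refine ⟨c 0, c 1, ?_⟩
  rw [← hc, Fin.sum_univ_two, linForm, smul_eq_C_mul, smul_eq_C_mul]

theorem linForm_zero {p q : ℂ} (h : linForm p q = 0) : p = 0 ∧ q = 0 := by
  have h0 := congrArg (eval ![1, 0]) h
  have h1 := congrArg (eval ![0, 1]) h
  simp [linForm] at h0 h1
  exact ⟨h0, h1⟩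

theorem linForm_smul (t p q : ℂ) : t • linForm p q = linForm (t * p) (t * q) := by
  simp only [linForm, smul_eq_C_mul, map_mul]; ring

theorem linForm_add (p q r s : ℂ) : linForm p q + linForm r s = linForm (p + r) (q + s) := by
  simp only [linForm, map_add]; ring

theorem linForm_indep {p q r s : ℂ} :
    LinearIndependent ℂ ![linForm p q, linForm r s] ↔ p * s - q * r ≠ 0 := by
  rw [LinearIndependent.pair_iff]
  constructor
  · intro h hd
    have h1 := h s (-q) (by
      rw [linForm_smul, linForm_smul, linForm_add]
      have e1 : s * p + -q * r = 0 := by linear_combination hd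
      have e2 : s * q + -q * s = 0 := by ring
      rw [e1, e2]; simp [linForm])
    have h2 := h r (-p) (by
      rw [linForm_smul, linForm_smul, linForm_add]
      have e1 : r * p + -p * r = 0 := by ring
      have e2 : r * q + -p * s = 0 := by linear_combination -hd
      rw [e1, e2]; simp [linForm])
    have hq : q = 0 := by simpa using h1.2
    have hp : p = 0 := by simpa using h2.2
    have := h 1 0 (by simp [linForm, hp, hq])
    simp at this
  · intro hd x y h
    rw [linForm_smul, linForm_smul, linForm_add] at h
    obtain ⟨h1, h2⟩ := linForm_zero h
    constructor
    · apply (mul_eq_zero.mp _).resolve_right hd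
      linear_combination s * h1 - r * h2
    · apply (mul_eq_zero.mp _).resolve_right hd
      linear_combination p * h2 - q * h1

/-- Coefficients of the sextic `a x^6 + b y^6 + c (x+y)^6 + d xy(x+y)(x-y)(x+2y)(2x+y)`. -/
noncomputable def baseCoef (a b c d : ℂ) : ℕ → ℂ := fun i =>
  if i = 0 then b + c else if i = 1 then c - d / 3 else if i = 2 then c - d / 3
  else if i = 3 then c else if i = 4 then c + d / 3 else if i = 5 then c + d / 3 else a + c

theorem base_sextic (a b c d : ℂ) (u v w : MvPolynomial (Fin 2) ℂ)
    (hu : u = linForm 1 0) (hv : v = linForm 0 1) (hw : w = linForm (-1) (-1)) :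
    MvPolynomial.C a * u ^ 6 + MvPolynomial.C b * v ^ 6 + MvPolynomial.C c * w ^ 6
        + MvPolynomial.C d * (u * v * w * (u - v) * (v - w) * (w - u))
      = sexticOf (baseCoef a b c d) := by
  have e1 : (15 : ℂ) * (c - d / 3) = 15 * c - 5 * d := by ring
  have e2 : (15 : ℂ) * (c + d / 3) = 15 * c + 5 * d := by ring
  have e3 : (6 : ℂ) * (c - d / 3) = 6 * c - 2 * d := by ring
  have e4 : (6 : ℂ) * (c + d / 3) = 6 * c + 2 * d := by ring
  subst hu hv hw
  simp only [sexticOf, baseCoef, Finset.sum_range_succ, Finset.sum_range_zero, Nat.choose, linForm]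
  norm_num [e1, e2, e3, e4, -map_div₀]
  simp only [map_ofNat]
  ring

theorem base_eigen (a b c d : ℂ) :
    qhatApply (baseCoef a b c d) ![0, 1, 1, 0] = MvPolynomial.C (-d) * cubicOf ![0, 1, 1, 0] := by
  rw [C_mul_cubic, qhatApply]
  congr 1
  funext i
  fin_cases i <;> simp [baseCoef] <;> ring

theorem qhat_congr {a a' : ℕ → ℂ} (h : ∀ i < 7, a i = a' i) (b : Fin 4 → ℂ) :
    qhatApply a b = qhatApply a' b := by
  simp [qhatApply, h]

/-- A binary sextic `Q` is linearly equivalent to a sextic in Sylvester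
Canonical Form if and only if the endomorphism `Q̂` has a square-free eigencubic. -/
theorem sylvester_iff_squarefree_eigencubic (a : ℕ → ℂ) :
    (∃ S, IsSylvester S ∧ LinEquiv (sexticOf a) S) ↔
    (∃ (lam : ℂ) (b : Fin 4 → ℂ), Squarefree (cubicOf b) ∧
      qhatApply a b = MvPolynomial.C lam * cubicOf b) := by
  constructor
  · rintro ⟨S, ⟨α, β, γ, d, u, v, w, hu, hv, hw, hsum, huv, -, -, hS⟩, M, hM, hMS⟩
    obtain ⟨p, q, rfl⟩ := homog_one u hu
    obtain ⟨r, s, rfl⟩ := homog_one v hv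
    rw [linForm_indep] at huv
    have hw' : w = -(linForm p q + linForm r s) := by linear_combination hsum
    subst hw'
    set N : Matrix (Fin 2) (Fin 2) ℂ := !![p, q; r, s] with hN
    have hNd : IsUnit N.det := by
      rw [hN, Matrix.det_fin_two_of]; exact isUnit_iff_ne_zero.mpr huv
    have hSN : S = substMat N (sexticOf (baseCoef α β γ d)) := by
      rw [hS, ← base_sextic α β γ d _ _ _ rfl rfl rfl]
      simp only [substMat, linForm, map_add, map_mul, map_pow, map_sub, aeval_X, algHom_C,
        MvPolynomial.algebraMap_eq, hN, Matrix.of_apply, Matrix.cons_val, map_neg, map_one,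
        map_zero]
      ring
    set K := N * M⁻¹ with hK
    have hKd : IsUnit K.det := by
      rw [hK, Matrix.det_mul]
      exact hNd.mul ((Matrix.isUnit_nonsing_inv_det_iff).mpr hM)
    have hQ : sexticOf a = substMat K (sexticOf (baseCoef α β γ d)) := by
      rw [hK, ← substMat_comp, ← hSN, ← hMS, substMat_comp, Matrix.mul_nonsing_inv _ hM,
        substMat_one]
    rw [subst_sextic] at hQ
    refine ⟨(K 0 0 * K 1 1 - K 0 1 * K 1 0) ^ 3 * (-d),
      sub3 (K 0 0) (K 0 1) (K 1 0) (K 1 1) ![0, 1, 1, 0], ?_, ?_⟩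
    rotate_left
    · rw [qhat_congr (sextic_inj hQ)]
      exact equivar _ _ _ _ _ _ _ (base_eigen α β γ d)
    · rw [← subst_cubic]
      exact sqfree_subst K hKd _ sqfree_base
  · rintro ⟨lam, b, hb, heig⟩
    obtain ⟨p, q, r, s, hd, rfl⟩ := sqfree_normal b hb
    have h1 := equivar s (-q) (-r) p lam a _ heig
    have hadj : sub3 s (-q) (-r) p (sub3 p q r s ![0, 1, 1, 0])
        = ![0, (p * s - q * r) ^ 3, (p * s - q * r) ^ 3, 0] := by
      funext i
      fin_cases i <;> simp [sub3] <;> ring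
    have hd3 : (p * s - q * r) ^ 3 ≠ 0 := pow_ne_zero 3 hd
    rw [hadj, C_mul_cubic, qhatApply] at h1
    have h2 := cubic_inj h1
    set A := sub6 s (-q) (-r) p a with hA
    generalize (p * s - q * r) ^ 3 = δ at h2 hd3
    generalize (s * p - -q * -r) ^ 3 * lam = μ at h2
    have f0 := congrFun h2 0
    have f1 := congrFun h2 1
    have f2 := congrFun h2 2
    have f3 := congrFun h2 3
    simp at f0 f1 f2 f3
    have g45 : A 5 = A 4 := by
      apply mul_right_cancel₀ hd3; linear_combination -f0
    have g12 : A 1 = A 2 := by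
      apply mul_right_cancel₀ hd3; linear_combination f3
    have g3 : A 3 = (A 2 + A 4) / 2 := by
      apply mul_right_cancel₀ hd3; linear_combination (f1 - f2) / 6
    refine ⟨sexticOf A, ?_, !![s, -q; -r, p], ?_, ?_⟩
    · refine ⟨A 6 - A 3, A 0 - A 3, A 3, 3 * (A 4 - A 2) / 2, linForm 1 0, linForm 0 1,
        linForm (-1) (-1), ?_, ?_, ?_, ?_, ?_, ?_, ?_, ?_⟩
      · exact (isHomogeneous_C_mul_X _ _).add (isHomogeneous_C_mul_X _ _)
      · exact (isHomogeneous_C_mul_X _ _).add (isHomogeneous_C_mul_X _ _)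
      · exact (isHomogeneous_C_mul_X _ _).add (isHomogeneous_C_mul_X _ _)
      · simp only [linForm_add]; simp [linForm]
      · rw [linForm_indep]; norm_num
      · rw [linForm_indep]; norm_num
      · rw [linForm_indep]; norm_num
      · rw [base_sextic _ _ _ _ _ _ _ rfl rfl rfl]
        unfold sexticOf
        apply Finset.sum_congr rfl
        intro i hi
        have : A i = baseCoef (A 6 - A 3) (A 0 - A 3) (A 3) (3 * (A 4 - A 2) / 2) i := by
          have hi' := Finset.mem_range.mp hi
          interval_cases i <;> simp [baseCoef, g45, g12, g3] <;> ring
        rw [this]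
    · rw [Matrix.det_fin_two_of]
      apply isUnit_iff_ne_zero.mpr
      intro h
      exact hd (by linear_combination h)
    · rw [subst_sextic]
      simp [hA]
end

section
/- Let s, t ∈ ℂ and let r1, …, r5 ∈ ℂ be such that X^5 + s·X^4 + t·X^3 + 1 = (X − r1)(X − r2)(X − r3)(X − r4)(X − r5) in ℂ[X]. Then ∏_{1 ≤ α < β ≤ 5} (r_α − r_β)^2 = 256s^5 − 1600s^3t − 27s^2t^4 + 2250st^2 + 108t^5 + 3125. -/
open Polynomial Finset

/-- If `X^5 + s X^4 + t X^3 + 1` factors as `∏ (X - rᵢ)` over `ℂ`, then the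
product of squared differences of the roots equals
`256 s^5 − 1600 s^3 t − 27 s^2 t^4 + 2250 s t^2 + 108 t^5 + 3125`. -/
theorem discriminant_of_quintic_fst (s t : ℂ) (r : Fin 5 → ℂ)
    (h : (X ^ 5 + C s * X ^ 4 + C t * X ^ 3 + 1 : Polynomial ℂ)
        = ∏ i : Fin 5, (X - C (r i))) :
    (∏ p ∈ Finset.univ.filter (fun p : Fin 5 × Fin 5 => p.1 < p.2), (r p.1 - r p.2) ^ 2)
      = 256 * s ^ 5 - 1600 * s ^ 3 * t - 27 * s ^ 2 * t ^ 4 + 2250 * s * t ^ 2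
        + 108 * t ^ 5 + 3125 := by
  have hev : ∀ x : ℂ, x ^ 5 + s * x ^ 4 + t * x ^ 3 + 1
      = (x - r 0) * (x - r 1) * (x - r 2) * (x - r 3) * (x - r 4) := by
    intro x
    have := congrArg (eval x) h
    simpa [Fin.prod_univ_five] using this
  have hd : ∀ x : ℂ, x ^ 2 * (5 * x ^ 2 + 4 * s * x + 3 * t)
      = (x - r 1) * (x - r 2) * (x - r 3) * (x - r 4)
      + (x - r 0) * (x - r 2) * (x - r 3) * (x - r 4)
      + (x - r 0) * (x - r 1) * (x - r 3) * (x - r 4)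
      + (x - r 0) * (x - r 1) * (x - r 2) * (x - r 4)
      + (x - r 0) * (x - r 1) * (x - r 2) * (x - r 3) := by
    intro x
    have := congrArg (fun p => eval x (derivative p)) h
    simp [Fin.prod_univ_five, derivative_mul] at this
    linear_combination this
  -- roots of the quadratic factor of the derivative
  obtain ⟨w, hw⟩ := IsAlgClosed.exists_pow_nat_eq (4 * s ^ 2 - 15 * t) (n := 2) (by norm_num)
  obtain ⟨a, ha⟩ : ∃ a, a = (-2 * s + w) / 5 := ⟨_, rfl⟩
  obtain ⟨b, hb⟩ : ∃ b, b = (-2 * s - w) / 5 := ⟨_, rfl⟩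
  have hs : s = -5 / 4 * (a + b) := by rw [ha, hb]; ring
  have ht : t = 5 / 3 * (a * b) := by
    rw [ha, hb]; linear_combination (1 / 15) * hw
  have hq : ∀ x : ℂ, 5 * x ^ 2 + 4 * s * x + 3 * t = 5 * ((a - x) * (b - x)) := by
    intro x
    rw [hs, ht]; ring
  have h1 : (r 0 * r 1 * r 2 * r 3 * r 4) = -1 := by
    linear_combination hev 0
  have hprod : (∏ p ∈ Finset.univ.filter (fun p : Fin 5 × Fin 5 => p.1 < p.2),
      (r p.1 - r p.2) ^ 2)
      = ((r 0 - r 1) * (r 0 - r 2) * (r 0 - r 3) * (r 0 - r 4) * (r 1 - r 2) * (r 1 - r 3)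
        * (r 1 - r 4) * (r 2 - r 3) * (r 2 - r 4) * (r 3 - r 4)) ^ 2 := by
    rw [Finset.prod_filter, Fintype.prod_prod_type]
    simp [Fin.prod_univ_five]
    ring
  have e0 : (r 0 - r 1) * (r 0 - r 2) * (r 0 - r 3) * (r 0 - r 4)
      = r 0 ^ 2 * (5 * ((a - r 0) * (b - r 0))) := by
    rw [← hq, hd]; ring
  have e1 : (r 1 - r 0) * (r 1 - r 2) * (r 1 - r 3) * (r 1 - r 4)
      = r 1 ^ 2 * (5 * ((a - r 1) * (b - r 1))) := by
    rw [← hq, hd]; ring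
  have e2 : (r 2 - r 0) * (r 2 - r 1) * (r 2 - r 3) * (r 2 - r 4)
      = r 2 ^ 2 * (5 * ((a - r 2) * (b - r 2))) := by
    rw [← hq, hd]; ring
  have e3 : (r 3 - r 0) * (r 3 - r 1) * (r 3 - r 2) * (r 3 - r 4)
      = r 3 ^ 2 * (5 * ((a - r 3) * (b - r 3))) := by
    rw [← hq, hd]; ring
  have e4 : (r 4 - r 0) * (r 4 - r 1) * (r 4 - r 2) * (r 4 - r 3)
      = r 4 ^ 2 * (5 * ((a - r 4) * (b - r 4))) := by
    rw [← hq, hd]; ring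
  have flip : ∀ i j : Fin 5, r j - r i = -(r i - r j) := fun i j => by ring
  have key : ((r 0 - r 1) * (r 0 - r 2) * (r 0 - r 3) * (r 0 - r 4) * (r 1 - r 2) * (r 1 - r 3)
        * (r 1 - r 4) * (r 2 - r 3) * (r 2 - r 4) * (r 3 - r 4)) ^ 2
      = ((r 0 - r 1) * (r 0 - r 2) * (r 0 - r 3) * (r 0 - r 4))
        * ((r 1 - r 0) * (r 1 - r 2) * (r 1 - r 3) * (r 1 - r 4))
        * ((r 2 - r 0) * (r 2 - r 1) * (r 2 - r 3) * (r 2 - r 4))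
        * ((r 3 - r 0) * (r 3 - r 1) * (r 3 - r 2) * (r 3 - r 4))
        * ((r 4 - r 0) * (r 4 - r 1) * (r 4 - r 2) * (r 4 - r 3)) := by
    rw [flip 0 1, flip 0 2, flip 0 3, flip 0 4, flip 1 2, flip 1 3, flip 1 4, flip 2 3,
      flip 2 4, flip 3 4]
    generalize r 0 - r 1 = d01
    generalize r 0 - r 2 = d02
    generalize r 0 - r 3 = d03
    generalize r 0 - r 4 = d04
    generalize r 1 - r 2 = d12
    generalize r 1 - r 3 = d13
    generalize r 1 - r 4 = d14
    generalize r 2 - r 3 = d23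
    generalize r 2 - r 4 = d24
    generalize r 3 - r 4 = d34
    ring
  have fin : (r 0 ^ 2 * (5 * ((a - r 0) * (b - r 0)))) * (r 1 ^ 2 * (5 * ((a - r 1) * (b - r 1))))
      * (r 2 ^ 2 * (5 * ((a - r 2) * (b - r 2)))) * (r 3 ^ 2 * (5 * ((a - r 3) * (b - r 3))))
      * (r 4 ^ 2 * (5 * ((a - r 4) * (b - r 4))))
      = 3125 * (r 0 * r 1 * r 2 * r 3 * r 4) ^ 2
        * (((a - r 0) * (a - r 1) * (a - r 2) * (a - r 3) * (a - r 4))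
        * ((b - r 0) * (b - r 1) * (b - r 2) * (b - r 3) * (b - r 4))) := by
    generalize a - r 0 = a0
    generalize a - r 1 = a1
    generalize a - r 2 = a2
    generalize a - r 3 = a3
    generalize a - r 4 = a4
    generalize b - r 0 = b0
    generalize b - r 1 = b1
    generalize b - r 2 = b2
    generalize b - r 3 = b3
    generalize b - r 4 = b4
    ring
  rw [hprod, key, e0, e1, e2, e3, e4, fin, h1, ← hev a, ← hev b, hs, ht]
  ring
end
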